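/- arXiv:2511.12527 — 5 statements merged into one kernel-verified Lean document; each statement's English description precedes it below -/
import Mathlib

section
/- Let n1, n2 ≥ 2 be integers with n1·n2 odd, let τ1, τ2 ∈ ℝ be such that there exist z1, z2 ∈ ℂ with z1² = τ1, z2² = τ2 and the pair (z1,z2) (n1,n2)-independent, and let s ≥ 2n1n2 be an integer. Then the square matrix M(s) of order 2n1n2−1 has rank exactly 2n1n2−2. -/
open Matrix Kronecker

noncomputable section

/-- The modified Kac matrix `𝒦(n,y)`: its 1-based entry `(i,j)` equals `(n-j)·y` if `j = i-1`,
equals `i` if `j = i+1`, and equals `0` otherwise. -/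
def kacM (R : Type*) [CommRing R] (n : ℕ) (y : R) : Matrix (Fin n) (Fin n) R :=
  Matrix.of fun i j =>
    if (i : ℕ) = (j : ℕ) + 1 then ((n - 1 - (j : ℕ) : ℕ) : R) * y
    else if (j : ℕ) = (i : ℕ) + 1 then (((i : ℕ) + 1 : ℕ) : R)
    else 0

/-- The modified Kac matrix of second type `K(n1,n2,x,y)`, indexed by pairs
`(block index, index inside block)`; the pair `(u,v)` (0-based) corresponds to the
1-based position `u·n2 + v + 1`.  Its `n2×n2` blocks `K_{ij}` (1-based) are
`𝒦(n2,y)` if `i = j`, `(n1-j)·x·I` if `j = i-1`, `i·I` if `j = i+1`, and `0` otherwise. -/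
def kac2M (R : Type*) [CommRing R] (n1 n2 : ℕ) (x y : R) :
    Matrix (Fin n1 × Fin n2) (Fin n1 × Fin n2) R :=
  Matrix.of fun p q =>
    if p.1 = q.1 then kacM R n2 y p.2 q.2
    else if (p.1 : ℕ) = (q.1 : ℕ) + 1 then
      (if p.2 = q.2 then ((n1 - 1 - (q.1 : ℕ) : ℕ) : R) * x else 0)
    else if (q.1 : ℕ) = (p.1 : ℕ) + 1 then
      (if p.2 = q.2 then (((p.1 : ℕ) + 1 : ℕ) : R) else 0)
    else 0

/-- A pair `(z1,z2)` of complex numbers is `(n1,n2)`-independent if, for all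
`a1, b1 ∈ 𝒩₁ = {n1-1-2r : 0 ≤ r ≤ n1-1}` and `a2, b2 ∈ 𝒩₂ = {n2-1-2r : 0 ≤ r ≤ n2-1}`,
`(a1-b1)z1 + (a2-b2)z2 = 0` implies `a1 = b1` and `a2 = b2`. -/
def IndepPair (n1 n2 : ℕ) (z1 z2 : ℂ) : Prop :=
  ∀ a1 b1 a2 b2 : ℤ,
    (∃ r : ℕ, r < n1 ∧ a1 = (n1 : ℤ) - 1 - 2 * r) →
    (∃ r : ℕ, r < n1 ∧ b1 = (n1 : ℤ) - 1 - 2 * r) →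
    (∃ r : ℕ, r < n2 ∧ a2 = (n2 : ℤ) - 1 - 2 * r) →
    (∃ r : ℕ, r < n2 ∧ b2 = (n2 : ℤ) - 1 - 2 * r) →
    ((a1 - b1 : ℤ) : ℂ) * z1 + ((a2 - b2 : ℤ) : ℂ) * z2 = 0 →
    a1 = b1 ∧ a2 = b2

/-- `K(n1,n2,x,y)` as a matrix indexed by `Fin (n1·n2)`, placing the pair `(u,v)` at the
0-based position `u·n2 + v`. -/
def kac2Fin (n1 n2 : ℕ) (x y : ℝ) : Matrix (Fin (n1 * n2)) (Fin (n1 * n2)) ℝ :=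
  Matrix.reindex finProdFinEquiv finProdFinEquiv (kac2M ℝ n1 n2 x y)

/-- The matrix `Q(n1,n2,τ1,τ2) = [[K, I],[0, K]]` (blocks of order `n1·n2`),
where `K = K(n1,n2,τ1,τ2)`, indexed by `Fin (2·n1·n2)`. -/
def Qmat (n1 n2 : ℕ) (τ1 τ2 : ℝ) :
    Matrix (Fin (2 * (n1 * n2))) (Fin (2 * (n1 * n2))) ℝ :=
  Matrix.reindex (finSumFinEquiv.trans (finCongr (two_mul (n1 * n2)).symm))
    (finSumFinEquiv.trans (finCongr (two_mul (n1 * n2)).symm))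
    (Matrix.fromBlocks (kac2Fin n1 n2 τ1 τ2) 1 0 (kac2Fin n1 n2 τ1 τ2))

/-- The first standard basis row vector `e1 = (1,0,…,0)` of `ℝ^n`. -/
def e1v (n : ℕ) : Fin n → ℝ := fun i => if (i : ℕ) = 0 then 1 else 0

/-- The `(2n1n2-1) × (2n1n2)` matrix `M̄(n1,n2,τ1,τ2)` whose `i`-th row (1-based) is
the row vector `e1·Q^{i+1}`. -/
def Mbar (n1 n2 : ℕ) (τ1 τ2 : ℝ) :
    Matrix (Fin (2 * (n1 * n2) - 1)) (Fin (2 * (n1 * n2))) ℝ :=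
  Matrix.of fun i j =>
    Matrix.vecMul (e1v (2 * (n1 * n2))) (Qmat n1 n2 τ1 τ2 ^ ((i : ℕ) + 2)) j

/-- The square matrix `M(n1,n2,τ1,τ2)` of order `2n1n2-1` obtained from `M̄` by deleting
its first column. -/
def Mmat (n1 n2 : ℕ) (τ1 τ2 : ℝ) :
    Matrix (Fin (2 * (n1 * n2) - 1)) (Fin (2 * (n1 * n2) - 1)) ℝ :=
  Matrix.of fun i j =>
    Mbar n1 n2 τ1 τ2 i ⟨(j : ℕ) + 1, by have := j.isLt; omega⟩

/-- For `n1·n2` odd and `s ≥ 2n1n2`: the `(2n1n2-1) × (2n1n2)` matrix `M̄(s)` whose rows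
are, in order, `e1·Q^2, e1·Q^3, …, e1·Q^{2n1n2-1}, e1·Q^s`. -/
def MbarS (n1 n2 : ℕ) (τ1 τ2 : ℝ) (s : ℕ) :
    Matrix (Fin (2 * (n1 * n2) - 1)) (Fin (2 * (n1 * n2))) ℝ :=
  Matrix.of fun i j =>
    Matrix.vecMul (e1v (2 * (n1 * n2)))
      (Qmat n1 n2 τ1 τ2 ^ (if (i : ℕ) + 2 < 2 * (n1 * n2) then (i : ℕ) + 2 else s)) j

/-- The square matrix `M(s)` of order `2n1n2-1` obtained from `M̄(s)` by deleting its
first column. -/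
def MmatS (n1 n2 : ℕ) (τ1 τ2 : ℝ) (s : ℕ) :
    Matrix (Fin (2 * (n1 * n2) - 1)) (Fin (2 * (n1 * n2) - 1)) ℝ :=
  Matrix.of fun i j =>
    MbarS n1 n2 τ1 τ2 s i ⟨(j : ℕ) + 1, by have := j.isLt; omega⟩


/-- Generating polynomial of a right eigenvector of the Kac matrix. -/
def genP (n r : ℕ) (z : ℂ) : Polynomial ℂ :=
  (1 + Polynomial.C z * Polynomial.X) ^ (n - 1 - r) * (1 - Polynomial.C z * Polynomial.X) ^ r

lemma genP_coeff_zero (n r : ℕ) (z : ℂ) : (genP n r z).coeff 0 = 1 := by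
  rw [Polynomial.coeff_zero_eq_eval_zero]
  simp [genP]

lemma genP_natDegree (n r : ℕ) (hr : r < n) (z : ℂ) : (genP n r z).natDegree < n := by
  have h1 : (1 + Polynomial.C z * Polynomial.X : Polynomial ℂ).natDegree ≤ 1 := by compute_degree
  have h2 : (1 - Polynomial.C z * Polynomial.X : Polynomial ℂ).natDegree ≤ 1 := by compute_degree
  have := Polynomial.natDegree_mul_le_of_le
    (Polynomial.natDegree_pow_le_of_le (n - 1 - r) h1) (Polynomial.natDegree_pow_le_of_le r h2)
  unfold genP
  omega

lemma pow_der (p : Polynomial ℂ) (m : ℕ) :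
    p * Polynomial.derivative (p ^ m) = (m : Polynomial ℂ) * p ^ m * Polynomial.derivative p := by
  cases m with
  | zero => simp
  | succ k => rw [Polynomial.derivative_pow]; simp; ring

lemma genP_ode (n r : ℕ) (hr : r < n) (z : ℂ) :
    Polynomial.derivative (genP n r z)
      + Polynomial.C (((n : ℂ) - 1) * z ^ 2) * (Polynomial.X * genP n r z)
      - Polynomial.C (z ^ 2) * (Polynomial.X * (Polynomial.X * Polynomial.derivative (genP n r z)))
      = Polynomial.C (((n : ℂ) - 1 - 2 * r) * z) * genP n r z := by
  obtain ⟨m, rfl⟩ : ∃ m, n = m + r + 1 := ⟨n - 1 - r, by omega⟩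
  have e : m + r + 1 - 1 - r = m := by omega
  have h1 := pow_der (1 + Polynomial.C z * Polynomial.X) m
  have h2 := pow_der (1 - Polynomial.C z * Polynomial.X) r
  unfold genP
  rw [e, Polynomial.derivative_mul]
  simp only [Polynomial.derivative_add, Polynomial.derivative_sub, Polynomial.derivative_one,
    Polynomial.derivative_X, Polynomial.derivative_mul,
    Polynomial.derivative_C] at h1 h2
  simp only [map_mul, map_sub, map_pow, map_natCast, map_one, Nat.cast_add, Nat.cast_one, map_add,
    map_ofNat]
  generalize Polynomial.derivative ((1 + Polynomial.C z * Polynomial.X) ^ m) = A at *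
  generalize Polynomial.derivative ((1 - Polynomial.C z * Polynomial.X) ^ r) = B at *
  linear_combination (1 - Polynomial.C z * Polynomial.X) * (1 - Polynomial.C z * Polynomial.X) ^ r * h1
    + (1 + Polynomial.C z * Polynomial.X) * (1 + Polynomial.C z * Polynomial.X) ^ m * h2

/-- recurrence for coefficients -/
lemma genP_rec (n r : ℕ) (hr : r < n) (z : ℂ) (i : ℕ) :
    ((i : ℂ) + 1) * (genP n r z).coeff (i + 1)
      + (if 1 ≤ i then ((n : ℂ) - i) * z ^ 2 * (genP n r z).coeff (i - 1) else 0)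
      = ((n : ℂ) - 1 - 2 * r) * z * (genP n r z).coeff i := by
  have h := congrArg (fun p => Polynomial.coeff p i) (genP_ode n r hr z)
  simp only [Polynomial.coeff_add, Polynomial.coeff_sub, Polynomial.coeff_C_mul,
    Polynomial.coeff_derivative] at h
  rw [← h]
  rcases i with _ | _ | i
  · simp
  · simp [Polynomial.coeff_X_mul]
    ring
  · simp [Polynomial.coeff_X_mul, Polynomial.coeff_derivative]
    ring

/-- Right eigenvectors of the Kac matrix. -/
def kacVec (n r : ℕ) (z : ℂ) : Fin n → ℂ := fun i => (genP n r z).coeff i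

lemma kacM_mulVec (n r : ℕ) (hr : r < n) (z : ℂ) (i : Fin n) :
    ∑ j, kacM ℂ n (z ^ 2) i j * kacVec n r z j
      = ((n : ℂ) - 1 - 2 * r) * z * kacVec n r z i := by
  have h := genP_rec n r hr z i
  unfold kacVec
  rw [← h]
  have key : ∀ j : Fin n, kacM ℂ n (z ^ 2) i j * (genP n r z).coeff j
      = (if (j : ℕ) = (i : ℕ) + 1 then ((i : ℂ) + 1) * (genP n r z).coeff ((i : ℕ) + 1) else 0)
      + (if (i : ℕ) = (j : ℕ) + 1 then ((n : ℂ) - i) * z ^ 2 * (genP n r z).coeff ((i : ℕ) - 1)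
          else 0) := by
    intro j
    have hj := j.isLt
    simp only [kacM, Matrix.of_apply]
    by_cases h1 : (i : ℕ) = (j : ℕ) + 1
    · have h2 : ¬ ((j : ℕ) = (i : ℕ) + 1) := by omega
      have h3 : ((n - 1 - (j : ℕ) : ℕ) : ℂ) = (n : ℂ) - ((i : ℕ) : ℂ) := by
        rw [Nat.sub_sub, Nat.cast_sub (by omega), h1]; push_cast; ring
      rw [if_pos h1, if_neg h2, if_pos h1, h3, h1]
      simp
    · rw [if_neg h1, if_neg h1]
      by_cases h2 : (j : ℕ) = (i : ℕ) + 1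
      · rw [if_pos h2, if_pos h2, h2]; push_cast; ring
      · rw [if_neg h2, if_neg h2]; simp
  rw [Finset.sum_congr rfl (fun j _ => key j), Finset.sum_add_distrib]
  congr 1
  · by_cases hi : (i : ℕ) + 1 < n
    · rw [Finset.sum_eq_single (⟨(i : ℕ) + 1, hi⟩ : Fin n)]
      · simp
      · intro b _ hb
        rw [if_neg]
        intro h'; exact hb (Fin.ext h')
      · simp
    · rw [Finset.sum_eq_zero]
      · rw [Polynomial.coeff_eq_zero_of_natDegree_lt]
        · simp
        · have := genP_natDegree n r hr z; omega
      · intro j _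
        rw [if_neg]
        have := j.isLt; omega
  · by_cases hi : 1 ≤ (i : ℕ)
    · rw [if_pos hi, Finset.sum_eq_single (⟨(i : ℕ) - 1, by have := i.isLt; omega⟩ : Fin n)]
      · rw [if_pos]; simp; omega
      · intro b _ hb
        rw [if_neg]
        intro h'; exact hb (Fin.ext (by simp; omega))
      · simp
    · rw [if_neg hi, Finset.sum_eq_zero]
      intro j _
      rw [if_neg]; omega

lemma kac2M_eq (n1 n2 : ℕ) (x y : ℂ) (p q : Fin n1 × Fin n2) :
    kac2M ℂ n1 n2 x y p q
      = (if p.1 = q.1 then kacM ℂ n2 y p.2 q.2 else 0)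
        + (if p.2 = q.2 then kacM ℂ n1 x p.1 q.1 else 0) := by
  simp only [kac2M, kacM, Matrix.of_apply, Fin.ext_iff]
  by_cases h1 : (p.1 : ℕ) = q.1
  · have a : ¬ ((p.1 : ℕ) = q.1 + 1) := by omega
    have b : ¬ ((q.1 : ℕ) = p.1 + 1) := by omega
    simp [h1]
  · by_cases h2 : (p.2 : ℕ) = q.2
    · simp [h1, h2]
    · simp [h1, h2]

lemma kac2M_mulVec (n1 n2 r1 r2 : ℕ) (hr1 : r1 < n1) (hr2 : r2 < n2) (z1 z2 : ℂ)
    (p : Fin n1 × Fin n2) :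
    ∑ q : Fin n1 × Fin n2, kac2M ℂ n1 n2 (z1 ^ 2) (z2 ^ 2) p q
        * (kacVec n1 r1 z1 q.1 * kacVec n2 r2 z2 q.2)
      = (((n1 : ℂ) - 1 - 2 * r1) * z1 + ((n2 : ℂ) - 1 - 2 * r2) * z2)
        * (kacVec n1 r1 z1 p.1 * kacVec n2 r2 z2 p.2) := by
  simp only [kac2M_eq, add_mul, Finset.sum_add_distrib]
  have e1 := kacM_mulVec n1 r1 hr1 z1 p.1
  have e2 := kacM_mulVec n2 r2 hr2 z2 p.2
  rw [add_comm]
  congr 1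
  · rw [Fintype.sum_prod_type]
    simp only [ite_mul, zero_mul, Finset.sum_ite_eq, Finset.mem_univ, if_true]
    rw [← mul_assoc, ← e1, Finset.sum_mul]
    exact Finset.sum_congr rfl fun _ _ => by ring
  · rw [Fintype.sum_prod_type_right]
    simp only [ite_mul, zero_mul, Finset.sum_ite_eq, Finset.mem_univ, if_true]
    rw [mul_left_comm, ← e2, Finset.mul_sum]
    exact Finset.sum_congr rfl fun _ _ => by ring

/-- complexified Q -/
def Qc (n1 n2 : ℕ) (τ1 τ2 : ℝ) :
    Matrix (Fin (2 * (n1 * n2))) (Fin (2 * (n1 * n2))) ℂ :=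
  (Qmat n1 n2 τ1 τ2).map Complex.ofRealHom

/-- transport a vector to the index set of Q -/
def vecQ (n1 n2 : ℕ) (u v : Fin n1 × Fin n2 → ℂ) : Fin (2 * (n1 * n2)) → ℂ := fun i =>
  Sum.elim (fun a => u (finProdFinEquiv.symm a)) (fun a => v (finProdFinEquiv.symm a))
    ((finSumFinEquiv.trans (finCongr (two_mul (n1 * n2)).symm)).symm i)

lemma kac2M_map (n1 n2 : ℕ) (x y : ℝ) (p q : Fin n1 × Fin n2) :
    ((kac2M ℝ n1 n2 x y p q : ℝ) : ℂ) = kac2M ℂ n1 n2 x y p q := by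
  simp only [kac2M, kacM, Matrix.of_apply]
  split_ifs <;> simp

lemma Qc_mulVec (n1 n2 : ℕ) (τ1 τ2 : ℝ) (u v : Fin n1 × Fin n2 → ℂ) :
    Qc n1 n2 τ1 τ2 *ᵥ vecQ n1 n2 u v
      = vecQ n1 n2 (kac2M ℂ n1 n2 τ1 τ2 *ᵥ u + v) (kac2M ℂ n1 n2 τ1 τ2 *ᵥ v) := by
  funext i
  obtain ⟨i, rfl⟩ := (finSumFinEquiv.trans (finCongr (two_mul (n1 * n2)).symm)).surjective i
  have hk : ∀ (a : Fin (n1 * n2)) (t : Fin n1 × Fin n2 → ℂ),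
      ∑ b : Fin (n1 * n2), ((kac2Fin n1 n2 τ1 τ2 a b : ℝ) : ℂ) * t (finProdFinEquiv.symm b)
       = (kac2M ℂ n1 n2 τ1 τ2 *ᵥ t) (finProdFinEquiv.symm a) := by
    intro a t
    rw [← Equiv.sum_comp finProdFinEquiv]
    simp only [kac2Fin, Matrix.reindex_apply, Matrix.submatrix_apply, Equiv.symm_apply_apply,
      Matrix.mulVec, dotProduct, kac2M_map]
  simp only [Matrix.mulVec, dotProduct]
  rw [← Equiv.sum_comp (finSumFinEquiv.trans (finCongr (two_mul (n1 * n2)).symm))]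
  rw [Fintype.sum_sum_type]
  simp only [Qc, vecQ, Qmat, Matrix.map_apply, Matrix.reindex_apply, Matrix.submatrix_apply,
    Equiv.symm_apply_apply, Sum.elim_inl, Sum.elim_inr]
  rcases i with a | a
  · simp only [Matrix.fromBlocks_apply₁₁, Matrix.fromBlocks_apply₁₂, Sum.elim_inl,
      Complex.ofRealHom_eq_coe]
    rw [hk]
    simp [Matrix.one_apply, Matrix.mulVec, dotProduct, apply_ite Complex.ofReal]
  · simp only [Matrix.fromBlocks_apply₂₁, Matrix.fromBlocks_apply₂₂, Sum.elim_inr,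
      Complex.ofRealHom_eq_coe]
    rw [hk]
    simp [Matrix.mulVec, dotProduct]

/-- eigenvector of K -/
def ew (n1 n2 r1 r2 : ℕ) (z1 z2 : ℂ) : Fin n1 × Fin n2 → ℂ :=
  fun q => kacVec n1 r1 z1 q.1 * kacVec n2 r2 z2 q.2

/-- eigenvalue of K -/
def ev (n1 n2 r1 r2 : ℕ) (z1 z2 : ℂ) : ℂ :=
  ((n1 : ℂ) - 1 - 2 * r1) * z1 + ((n2 : ℂ) - 1 - 2 * r2) * z2

lemma vecQ_lin (n1 n2 : ℕ) (u v : Fin n1 × Fin n2 → ℂ) (a b : ℂ) :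
    vecQ n1 n2 (a • u + b • v) (a • v) = a • vecQ n1 n2 u v + b • vecQ n1 n2 v 0 := by
  funext i
  obtain ⟨i, rfl⟩ := (finSumFinEquiv.trans (finCongr (two_mul (n1 * n2)).symm)).surjective i
  simp only [vecQ, Equiv.symm_apply_apply, Pi.add_apply, Pi.smul_apply]
  rcases i with a | a <;> simp

lemma Qc_pow (n1 n2 r1 r2 : ℕ) (hr1 : r1 < n1) (hr2 : r2 < n2) (τ1 τ2 : ℝ) (z1 z2 : ℂ)
    (hz1 : z1 ^ 2 = (τ1 : ℂ)) (hz2 : z2 ^ 2 = (τ2 : ℂ)) (k : ℕ) (a b : ℂ) :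
    (Qc n1 n2 τ1 τ2) ^ k *ᵥ vecQ n1 n2 (a • ew n1 n2 r1 r2 z1 z2) (b • ew n1 n2 r1 r2 z1 z2)
      = vecQ n1 n2 ((a * ev n1 n2 r1 r2 z1 z2 ^ k + b * (k * ev n1 n2 r1 r2 z1 z2 ^ (k - 1)))
           • ew n1 n2 r1 r2 z1 z2)
          ((b * ev n1 n2 r1 r2 z1 z2 ^ k) • ew n1 n2 r1 r2 z1 z2) := by
  have hK : kac2M ℂ n1 n2 τ1 τ2 *ᵥ ew n1 n2 r1 r2 z1 z2
      = ev n1 n2 r1 r2 z1 z2 • ew n1 n2 r1 r2 z1 z2 := by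
    funext p
    rw [← hz1, ← hz2]
    exact kac2M_mulVec n1 n2 r1 r2 hr1 hr2 z1 z2 p
  induction k with
  | zero => simp
  | succ k ih =>
    rw [pow_succ', ← Matrix.mulVec_mulVec, ih, Qc_mulVec]
    simp only [Matrix.mulVec_smul, hK, smul_smul, ← add_smul]
    congr 2
    · rcases k with _ | k
      · simp
      · simp; ring
    · ring

lemma e1Q_dot (n1 n2 r1 r2 : ℕ) (hr1 : r1 < n1) (hr2 : r2 < n2) (τ1 τ2 : ℝ) (z1 z2 : ℂ)
    (hz1 : z1 ^ 2 = (τ1 : ℂ)) (hz2 : z2 ^ 2 = (τ2 : ℂ)) (k : ℕ) (a b : ℂ) :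
    ∑ j, ((Matrix.vecMul (e1v (2 * (n1 * n2))) (Qmat n1 n2 τ1 τ2 ^ k) j : ℝ) : ℂ)
        * vecQ n1 n2 (a • ew n1 n2 r1 r2 z1 z2) (b • ew n1 n2 r1 r2 z1 z2) j
      = a * ev n1 n2 r1 r2 z1 z2 ^ k + b * (k * ev n1 n2 r1 r2 z1 z2 ^ (k - 1)) := by
  have hN : 0 < n1 * n2 := Nat.mul_pos (by omega) (by omega)
  have hN2 : 0 < 2 * (n1 * n2) := by omega
  have h0 : ∀ j, Matrix.vecMul (e1v (2 * (n1 * n2))) (Qmat n1 n2 τ1 τ2 ^ k) j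
      = (Qmat n1 n2 τ1 τ2 ^ k) ⟨0, hN2⟩ j := by
    intro j
    simp only [Matrix.vecMul, dotProduct, e1v]
    rw [Finset.sum_eq_single (⟨0, hN2⟩ : Fin (2 * (n1 * n2)))]
    · simp
    · intro b _ hb
      rw [if_neg, zero_mul]
      intro h; exact hb (Fin.ext h)
    · simp
  have h1 : ∀ j, (((Qmat n1 n2 τ1 τ2 ^ k) ⟨0, hN2⟩ j : ℝ) : ℂ) = (Qc n1 n2 τ1 τ2 ^ k) ⟨0, hN2⟩ j := by
    intro j
    have : Qc n1 n2 τ1 τ2 ^ k = (Qmat n1 n2 τ1 τ2 ^ k).map Complex.ofRealHom := by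
      rw [Qc, Matrix.map_pow]
    rw [this]; rfl
  have h2 := congrFun (Qc_pow n1 n2 r1 r2 hr1 hr2 τ1 τ2 z1 z2 hz1 hz2 k a b) ⟨0, hN2⟩
  simp only [h0, h1]
  simp only [Matrix.mulVec, dotProduct] at h2
  rw [h2]
  have h3 : (⟨0, hN2⟩ : Fin (2 * (n1 * n2)))
      = (finSumFinEquiv.trans (finCongr (two_mul (n1 * n2)).symm))
        (Sum.inl (finProdFinEquiv (⟨0, by omega⟩, ⟨0, by omega⟩))) := by
    apply Fin.ext; simp
  rw [h3]
  simp only [vecQ, Equiv.symm_apply_apply, Sum.elim_inl, ew, kacVec, Pi.smul_apply, smul_eq_mul,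
    genP_coeff_zero, mul_one]

lemma poly_zero {ι : Type*} [Fintype ι] (l : ι → ℂ) (hl : Function.Injective l)
    (P : Polynomial ℂ) (hP : P.degree < ((2 * Fintype.card ι : ℕ) : WithBot ℕ))
    (h0 : ∀ i, P.eval (l i) = 0) (h1 : ∀ i, P.derivative.eval (l i) = 0) : P = 0 := by
  by_contra hne
  have hd : (∏ i, (Polynomial.X - Polynomial.C (l i)) ^ 2) ∣ P := by
    apply Fintype.prod_dvd_of_coprime
    · intro i j hij
      exact (Polynomial.pairwise_coprime_X_sub_C hl hij).pow
    · intro i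
      rw [← Polynomial.le_rootMultiplicity_iff hne]
      exact (Polynomial.one_lt_rootMultiplicity_iff_isRoot hne).2 ⟨h0 i, h1 i⟩
  apply hne
  apply Polynomial.eq_zero_of_dvd_of_degree_lt hd
  rw [Polynomial.degree_prod]
  simpa [mul_comm] using hP

lemma sum_split (m : ℕ) (hm : 0 < m) (f : Fin m → ℂ) :
    ∑ j, f j = f ⟨0, hm⟩ + ∑ j : Fin (m - 1), f ⟨(j : ℕ) + 1, by have := j.isLt; omega⟩ := by
  obtain ⟨k, rfl⟩ : ∃ k, m = k + 1 := ⟨m - 1, by omega⟩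
  rw [Fin.sum_univ_succ]
  rfl

lemma vecQ_first (n1 n2 r1 r2 : ℕ) (hr1 : r1 < n1) (hr2 : r2 < n2) (z1 z2 : ℂ) (a b : ℂ)
    (hN2 : 0 < 2 * (n1 * n2)) :
    vecQ n1 n2 (a • ew n1 n2 r1 r2 z1 z2) (b • ew n1 n2 r1 r2 z1 z2) ⟨0, hN2⟩ = a := by
  have h3 : (⟨0, hN2⟩ : Fin (2 * (n1 * n2)))
      = (finSumFinEquiv.trans (finCongr (two_mul (n1 * n2)).symm))
        (Sum.inl (finProdFinEquiv (⟨0, by omega⟩, ⟨0, by omega⟩))) := by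
    apply Fin.ext; simp
  rw [h3]
  simp only [vecQ, Equiv.symm_apply_apply, Sum.elim_inl, ew, kacVec, Pi.smul_apply, smul_eq_mul,
    genP_coeff_zero, mul_one]

lemma MmatS_det (n1 n2 : ℕ) (hodd : Odd (n1 * n2)) (τ1 τ2 : ℝ) (z1 z2 : ℂ)
    (hz1 : z1 ^ 2 = (τ1 : ℂ)) (hz2 : z2 ^ 2 = (τ2 : ℂ)) (s : ℕ) (hs : 2 * (n1 * n2) ≤ s) :
    (MmatS n1 n2 τ1 τ2 s).det = 0 := by
  obtain ⟨⟨r1, e1⟩, ⟨r2, e2⟩⟩ := Nat.odd_mul.1 hodd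
  have hr1 : r1 < n1 := by omega
  have hr2 : r2 < n2 := by omega
  have hN : 0 < n1 * n2 := Nat.mul_pos (by omega) (by omega)
  have hN2 : 0 < 2 * (n1 * n2) := by omega
  have hev : ev n1 n2 r1 r2 z1 z2 = 0 := by
    simp only [ev, e1, e2]; push_cast; ring
  have hdot := fun k => e1Q_dot n1 n2 r1 r2 hr1 hr2 τ1 τ2 z1 z2 hz1 hz2 k 0 1
  have hf := vecQ_first n1 n2 r1 r2 hr1 hr2 z1 z2 0 1 hN2
  set W := vecQ n1 n2 ((0 : ℂ) • ew n1 n2 r1 r2 z1 z2) ((1 : ℂ) • ew n1 n2 r1 r2 z1 z2) with hW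
  simp only [sum_split _ hN2, hf, mul_zero, zero_add, hev, zero_mul, one_mul] at hdot
  have hc : ((MmatS n1 n2 τ1 τ2 s).map Complex.ofRealHom).det = 0 := by
    rw [← Matrix.exists_mulVec_eq_zero_iff]
    refine ⟨fun j => W ⟨(j : ℕ) + 1, by have := j.isLt; omega⟩, ?_, ?_⟩
    · intro h
      have h1 := hdot 1
      rw [Finset.sum_eq_zero] at h1
      · simp at h1
      · intro j _
        have := congrFun h j
        simp only [Pi.zero_apply] at this
        rw [this, mul_zero]
    · funext i
      simp only [Matrix.mulVec, dotProduct, Matrix.map_apply, MmatS, MbarS, Matrix.of_apply,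
        Complex.ofRealHom_eq_coe, Pi.zero_apply]
      rw [hdot]
      have : (if (i : ℕ) + 2 < 2 * (n1 * n2) then (i : ℕ) + 2 else s) - 1 ≠ 0 := by
        split_ifs <;> omega
      rw [zero_pow this, mul_zero]
  have := RingHom.map_det Complex.ofRealHom (MmatS n1 n2 τ1 τ2 s)
  rw [RingHom.mapMatrix_apply, hc] at this
  exact Complex.ofReal_eq_zero.1 this

lemma ev_inj (n1 n2 : ℕ) (z1 z2 : ℂ) (hind : IndepPair n1 n2 z1 z2) :
    Function.Injective (fun p : Fin n1 × Fin n2 => ev n1 n2 p.1 p.2 z1 z2) := by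
  intro p q h
  have := hind (n1 - 1 - 2 * (p.1 : ℕ)) (n1 - 1 - 2 * (q.1 : ℕ)) (n2 - 1 - 2 * (p.2 : ℕ))
    (n2 - 1 - 2 * (q.2 : ℕ)) ⟨_, p.1.isLt, rfl⟩ ⟨_, q.1.isLt, rfl⟩ ⟨_, p.2.isLt, rfl⟩
    ⟨_, q.2.isLt, rfl⟩ (by
      simp only [ev] at h
      push_cast
      linear_combination h)
  exact Prod.ext (Fin.ext (by omega)) (Fin.ext (by omega))

lemma rows_indep (n1 n2 : ℕ) (h1 : 2 ≤ n1) (h2 : 2 ≤ n2) (τ1 τ2 : ℝ) (z1 z2 : ℂ)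
    (hz1 : z1 ^ 2 = (τ1 : ℂ)) (hz2 : z2 ^ 2 = (τ2 : ℂ))
    (hind : IndepPair n1 n2 z1 z2) (s : ℕ) :
    LinearIndependent ℝ ((MmatS n1 n2 τ1 τ2 s).submatrix
      (fun i : Fin (2 * (n1 * n2) - 2) => (⟨(i : ℕ), by have := i.isLt; omega⟩ :
        Fin (2 * (n1 * n2) - 1))) id).row := by
  have hN : 0 < n1 * n2 := Nat.mul_pos (by omega) (by omega)
  have hN2 : 0 < 2 * (n1 * n2) := by omega
  rw [Fintype.linearIndependent_iff]
  intro c hc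
  set R : ℕ → Fin (2 * (n1 * n2)) → ℝ := fun k j =>
    Matrix.vecMul (e1v (2 * (n1 * n2))) (Qmat n1 n2 τ1 τ2 ^ k) j with hR
  set a : ℝ := ∑ i : Fin (2 * (n1 * n2) - 2), c i * R ((i : ℕ) + 2) ⟨0, hN2⟩ with ha
  have hrow : ∀ j : Fin (2 * (n1 * n2) - 1),
      ∑ i : Fin (2 * (n1 * n2) - 2), c i * R ((i : ℕ) + 2)
        ⟨(j : ℕ) + 1, by have := j.isLt; omega⟩ = 0 := by
    intro j
    have := congrFun hc j
    simp only [Finset.sum_apply, Pi.smul_apply, smul_eq_mul, Matrix.row, Matrix.submatrix_apply,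
      MmatS, MbarS, Matrix.of_apply, id, Pi.zero_apply] at this
    rw [← this]
    refine Finset.sum_congr rfl fun i _ => ?_
    rw [if_pos (by have := i.isLt; omega)]
  have key : ∀ (p : Fin n1 × Fin n2) (x y : ℂ),
      ∑ i : Fin (2 * (n1 * n2) - 2), (c i : ℂ) * (x * ev n1 n2 p.1 p.2 z1 z2 ^ ((i : ℕ) + 2)
        + y * (((i : ℕ) + 2 : ℕ) * ev n1 n2 p.1 p.2 z1 z2 ^ ((i : ℕ) + 1))) = a * x := by
    intro p x y
    have hdot := fun k => e1Q_dot n1 n2 p.1 p.2 p.1.isLt p.2.isLt τ1 τ2 z1 z2 hz1 hz2 k x y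
    have hf := vecQ_first n1 n2 p.1 p.2 p.1.isLt p.2.isLt z1 z2 x y hN2
    set W := vecQ n1 n2 (x • ew n1 n2 p.1 p.2 z1 z2) (y • ew n1 n2 p.1 p.2 z1 z2) with hW
    have e : ∀ i : Fin (2 * (n1 * n2) - 2), (x * ev n1 n2 p.1 p.2 z1 z2 ^ ((i : ℕ) + 2)
        + y * (((i : ℕ) + 2 : ℕ) * ev n1 n2 p.1 p.2 z1 z2 ^ ((i : ℕ) + 1)))
        = ∑ j, (R ((i : ℕ) + 2) j : ℂ) * W j := fun i => (hdot ((i : ℕ) + 2)).symm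
    simp only [e, Finset.mul_sum]
    rw [Finset.sum_comm, sum_split _ hN2, Finset.sum_eq_zero (s := (Finset.univ :
      Finset (Fin (2 * (n1 * n2) - 1))))]
    · simp only [← mul_assoc, ← Finset.sum_mul, hf, ha]
      push_cast
      ring
    · intro j _
      simp only [← mul_assoc, ← Finset.sum_mul]
      have := congrArg Complex.ofReal (hrow j)
      push_cast at this
      rw [this, zero_mul]
  set P : Polynomial ℂ := (∑ i : Fin (2 * (n1 * n2) - 2),
    Polynomial.C (c i : ℂ) * Polynomial.X ^ ((i : ℕ) + 2)) - Polynomial.C (a : ℂ) with hP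
  have hP0 : P = 0 := by
    apply poly_zero _ (ev_inj n1 n2 z1 z2 hind)
    · rw [hP]
      refine (Polynomial.degree_sub_le _ _).trans_lt (max_lt ?_ ?_)
      · refine (Polynomial.degree_sum_le _ _).trans_lt ?_
        rw [Finset.sup_lt_iff (by exact WithBot.bot_lt_coe _)]
        intro i _
        refine (Polynomial.degree_C_mul_X_pow_le _ _).trans_lt ?_
        have := i.isLt
        simp only [Fintype.card_prod, Fintype.card_fin]
        exact_mod_cast (by omega : (i : ℕ) + 2 < 2 * (n1 * n2))
      · refine Polynomial.degree_C_le.trans_lt ?_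
        simp only [Fintype.card_prod, Fintype.card_fin]
        exact_mod_cast hN2
    · intro p
      have := key p 1 0
      simp only [hP, Polynomial.eval_sub, Polynomial.eval_finsetSum, Polynomial.eval_mul,
        Polynomial.eval_C, Polynomial.eval_pow, Polynomial.eval_X]
      simp only [one_mul, zero_mul, add_zero, mul_one] at this
      rw [this, sub_self]
    · intro p
      have := key p 0 1
      simp only [hP, Polynomial.derivative_sub, Polynomial.derivative_sum,
        Polynomial.derivative_C_mul_X_pow, Polynomial.derivative_C, sub_zero,
        Polynomial.eval_finsetSum, Polynomial.eval_mul,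
        Polynomial.eval_C, Polynomial.eval_pow, Polynomial.eval_X]
      simp only [one_mul, zero_mul, zero_add, mul_zero] at this
      rw [← this]
      refine Finset.sum_congr rfl fun i _ => ?_
      rw [mul_assoc]
      rfl
  intro i
  have := congrArg (fun p => Polynomial.coeff p ((i : ℕ) + 2)) hP0
  simp only [hP, Polynomial.coeff_sub, Polynomial.finsetSum_coeff, Polynomial.coeff_C_mul_X_pow,
    Polynomial.coeff_C, Polynomial.coeff_zero] at this
  rw [Finset.sum_eq_single i] at this
  · simpa using this
  · intro b _ hb
    rw [if_neg]
    intro h; exact hb (Fin.ext (by omega))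
  · simp

/-- If `n1·n2` is odd, `τ1 = z1²`, `τ2 = z2²` with `(z1,z2)`
`(n1,n2)`-independent, and `s ≥ 2n1n2`, then the square matrix `M(s)` of order
`2n1n2-1` has rank exactly `2n1n2-2`. -/
theorem MmatS_rank (n1 n2 : ℕ) (h1 : 2 ≤ n1) (h2 : 2 ≤ n2)
    (hodd : Odd (n1 * n2)) (τ1 τ2 : ℝ) (z1 z2 : ℂ)
    (hz1 : z1 ^ 2 = (τ1 : ℂ)) (hz2 : z2 ^ 2 = (τ2 : ℂ))
    (hind : IndepPair n1 n2 z1 z2) (s : ℕ) (hs : 2 * (n1 * n2) ≤ s) :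
    (MmatS n1 n2 τ1 τ2 s).rank = 2 * (n1 * n2) - 2 := by
  have hN : 0 < n1 * n2 := Nat.mul_pos (by omega) (by omega)
  apply le_antisymm
  · obtain ⟨v, hv, hMv⟩ := Matrix.exists_mulVec_eq_zero_iff.2
      (MmatS_det n1 n2 hodd τ1 τ2 z1 z2 hz1 hz2 s hs)
    have hrk := LinearMap.finrank_range_add_finrank_ker (MmatS n1 n2 τ1 τ2 s).mulVecLin
    have hker : 0 < Module.finrank ℝ (LinearMap.ker (MmatS n1 n2 τ1 τ2 s).mulVecLin) := by
      rw [Module.finrank_pos_iff_exists_ne_zero]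
      refine ⟨⟨v, by simpa using hMv⟩, fun h => hv (congrArg Subtype.val h)⟩
    rw [Module.finrank_fin_fun] at hrk
    unfold Matrix.rank
    omega
  · have h := (rows_indep n1 n2 h1 h2 τ1 τ2 z1 z2 hz1 hz2 hind s).rank_matrix
    rw [Fintype.card_fin] at h
    rw [← h]
    exact Matrix.rank_submatrix_le _ _ _
end
end

section
/- Let n1, n2 ≥ 2 be integers and τ a nonzero real number. Then the modified Kac matrix of second type K(n1+1,n2,0,τ) is nonsingular if and only if n2 is even. -/
open Matrix Kronecker

noncomputable section

theorem kacM_det_odd (n : ℕ) (hn : Odd n) (τ : ℝ) : (kacM ℝ n τ).det = 0 := by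
  let D : Matrix (Fin n) (Fin n) ℝ := Matrix.diagonal fun i => (-1) ^ (i : ℕ)
  have hD : D * D = 1 := by
    simp only [D, Matrix.diagonal_mul_diagonal, ← mul_pow]
    simp
  have h : D * kacM ℝ n τ * D = - kacM ℝ n τ := by
    ext i j
    simp only [D, Matrix.mul_diagonal, Matrix.diagonal_mul, Matrix.neg_apply, kacM, Matrix.of_apply]
    split_ifs with h1 h2
    · rw [h1, pow_succ]
      have : ((-1 : ℝ) ^ (j : ℕ)) * (-1) ^ (j : ℕ) = 1 := by rw [← mul_pow]; simp
      linear_combination (-(((n - 1 - (j : ℕ) : ℕ) : ℝ) * τ)) * this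
    · rw [h2, pow_succ]
      have : ((-1 : ℝ) ^ (i : ℕ)) * (-1) ^ (i : ℕ) = 1 := by rw [← mul_pow]; simp
      linear_combination (-(((i : ℕ) + 1 : ℕ) : ℝ)) * this
    · simp
  have h2 := congrArg Matrix.det h
  have h3 := congrArg Matrix.det hD
  rw [Matrix.det_mul, Matrix.det_one] at h3
  rw [Matrix.det_mul, Matrix.det_mul, Matrix.det_neg, Fintype.card_fin, hn.neg_one_pow] at h2
  linear_combination (1 / 2 : ℝ) * h2 - (1 / 2 : ℝ) * (kacM ℝ n τ).det * h3

theorem kacM_det_even (n : ℕ) (hn : Even n) (τ : ℝ) (hτ : τ ≠ 0) : (kacM ℝ n τ).det ≠ 0 := by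
  intro hdet
  obtain ⟨v, hv, hKv⟩ := Matrix.exists_mulVec_eq_zero_iff.mpr hdet
  have row : ∀ i : Fin n, ∑ j, kacM ℝ n τ i j * v j = 0 := fun i => congrFun hKv i
  have hodd : ∀ k, ∀ h : 2 * k + 1 < n, v ⟨2 * k + 1, h⟩ = 0 := by
    intro k
    induction k with
    | zero =>
      intro h
      have r := row ⟨0, by omega⟩
      rw [Finset.sum_eq_single ⟨1, h⟩] at r
      · simpa [kacM] using r
      · intro b _ hb
        have hb' : (b : ℕ) ≠ 1 := fun e => hb (Fin.ext e)
        simp [kacM, hb']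
      · simp
    | succ k ih =>
      intro h
      have r := row ⟨2 * k + 2, by omega⟩
      rw [Finset.sum_eq_single ⟨2 * (k + 1) + 1, h⟩] at r
      · have e1 : ¬ (2 * k + 2 = 2 * (k + 1) + 1 + 1) := by omega
        have e2 : 2 * (k + 1) + 1 = 2 * k + 2 + 1 := by omega
        simp only [kacM, Matrix.of_apply, if_neg e1, if_pos e2] at r
        exact (mul_eq_zero.mp r).resolve_left (Nat.cast_ne_zero.mpr (by omega))
      · intro b _ hb
        have hb' : (b : ℕ) ≠ 2 * (k + 1) + 1 := fun e => hb (Fin.ext e)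
        by_cases hb2 : (b : ℕ) = 2 * k + 1
        · have : b = ⟨2 * k + 1, by omega⟩ := Fin.ext hb2
          rw [this, ih, mul_zero]
        · have e1 : ¬ (2 * k + 2 = (b : ℕ) + 1) := by omega
          have e2 : ¬ ((b : ℕ) = 2 * k + 2 + 1) := by omega
          simp only [kacM, Matrix.of_apply, if_neg e1, if_neg e2, zero_mul]
      · simp
  have heven : ∀ k j, ∀ h : j + 2 * k + 2 = n, v ⟨j, by omega⟩ = 0 := by
    intro k
    induction k with
    | zero =>
      intro j h
      have r := row ⟨j + 1, by omega⟩
      rw [Finset.sum_eq_single ⟨j, by omega⟩] at r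
      · simp only [kacM, Matrix.of_apply, if_true] at r
        exact (mul_eq_zero.mp r).resolve_left
          (mul_ne_zero (Nat.cast_ne_zero.mpr (by omega)) hτ)
      · intro b _ hb
        have hb' : (b : ℕ) ≠ j := fun e => hb (Fin.ext e)
        have e1 : ¬ (j + 1 = (b : ℕ) + 1) := by omega
        have e2 : ¬ ((b : ℕ) = j + 1 + 1) := by omega
        simp only [kacM, Matrix.of_apply, if_neg e1, if_neg e2, zero_mul]
      · simp
    | succ k ih =>
      intro j h
      have r := row ⟨j + 1, by omega⟩
      rw [Finset.sum_eq_single ⟨j, by omega⟩] at r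
      · simp only [kacM, Matrix.of_apply, if_true] at r
        exact (mul_eq_zero.mp r).resolve_left
          (mul_ne_zero (Nat.cast_ne_zero.mpr (by omega)) hτ)
      · intro b _ hb
        have hb' : (b : ℕ) ≠ j := fun e => hb (Fin.ext e)
        by_cases hb2 : (b : ℕ) = j + 2
        · have : b = ⟨j + 2, by omega⟩ := Fin.ext hb2
          rw [this, ih (j + 2) (by omega), mul_zero]
        · have e1 : ¬ (j + 1 = (b : ℕ) + 1) := by omega
          have e2 : ¬ ((b : ℕ) = j + 1 + 1) := by omega
          simp only [kacM, Matrix.of_apply, if_neg e1, if_neg e2, zero_mul]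
      · simp
  apply hv
  funext ⟨i, hi⟩
  obtain ⟨m, hm⟩ := hn
  rcases Nat.even_or_odd' i with ⟨c, hc | hc⟩
  · exact heven (m - 1 - c) i (by omega)
  · subst hc
    exact hodd c hi

theorem kac2M_det (n1 n2 : ℕ) (τ : ℝ) :
    (kac2M ℝ n1 n2 0 τ).det = (kacM ℝ n2 τ).det ^ n1 := by
  have hb : (kac2M ℝ n1 n2 0 τ).BlockTriangular Prod.fst := by
    intro p q hpq
    have h1 : p.1 ≠ q.1 := ne_of_gt hpq
    have h2 : ¬ ((q.1 : ℕ) = (p.1 : ℕ) + 1) := by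
      have : (q.1 : ℕ) < p.1 := hpq
      omega
    simp [kac2M, h1, h2]
  rw [hb.det_fintype]
  have : ∀ k : Fin n1, ((kac2M ℝ n1 n2 0 τ).toSquareBlock Prod.fst k).det
      = (kacM ℝ n2 τ).det := by
    intro k
    let e : Fin n2 ≃ {p : Fin n1 × Fin n2 // p.1 = k} :=
      { toFun := fun i => ⟨(k, i), rfl⟩
        invFun := fun p => p.1.2
        left_inv := fun _ => rfl
        right_inv := by rintro ⟨⟨a, b⟩, rfl⟩; rfl }
    rw [← Matrix.det_submatrix_equiv_self e]
    congr 1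
    ext i j
    simp [e, Matrix.toSquareBlock, Matrix.toSquareBlockProp, kac2M]
  simp [this]

/-- For integers `n1, n2 ≥ 2` and `τ ≠ 0` real, the modified Kac matrix
of second type `K(n1+1,n2,0,τ)` is nonsingular if and only if `n2` is even. -/
theorem kac2_flat_nonsingular_iff (n1 n2 : ℕ) (h1 : 2 ≤ n1) (h2 : 2 ≤ n2)
    (τ : ℝ) (hτ : τ ≠ 0) :
    (kac2M ℝ (n1 + 1) n2 0 τ).det ≠ 0 ↔ Even n2 := by
  rw [kac2M_det]
  constructor
  · intro h
    by_contra hn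
    rw [kacM_det_odd n2 (Nat.not_even_iff_odd.mp hn) τ] at h
    exact h (zero_pow (by omega))
  · intro h
    exact pow_ne_zero _ (kacM_det_even n2 h τ hτ)
end
end

section
/- Let n1, n2 ≥ 2 be integers with n2 even, let τ be a nonzero real number, and set Q = K(n1+1,n2,0,τ). Then for every integer s ≥ 1, the (n1+1)n2 row vectors e1·Q^s, e1·Q^{s+1}, …, e1·Q^{s+(n1+1)n2−1} in ℝ^{(n1+1)n2} are linearly independent, where e1 is the first standard basis row vector of ℝ^{(n1+1)n2}. -/
open Matrix Kronecker

noncomputable section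

/-- The first standard basis row vector `e1 = (1,0,…,0)` of `ℝ^{n1·n2}`, with `ℝ^{n1·n2}`
indexed by pairs `(u,v)` (the pair `(u,v)` is at 1-based position `u·n2+v+1`). -/
def e1p (n1 n2 : ℕ) : Fin n1 × Fin n2 → ℝ :=
  fun p => if (p.1 : ℕ) = 0 ∧ (p.2 : ℕ) = 0 then 1 else 0

open Polynomial in
lemma aux_pow_deriv (r : ℂ) (a : ℕ) :
    (1 + C r * X) * derivative ((1 + C r * X : ℂ[X]) ^ a) = (a : ℂ[X]) * C r * (1 + C r * X) ^ a := by
  cases a with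
  | zero => simp
  | succ m =>
    rw [derivative_pow_succ]
    simp only [derivative_add, derivative_one, derivative_mul, derivative_C, derivative_X]
    push_cast
    simp
    ring

open Polynomial in
/-- generating polynomial of an eigenvector of the Kac matrix -/
def kacPoly (r : ℂ) (a b : ℕ) : ℂ[X] := (1 + C r * X) ^ a * (1 + C (-r) * X) ^ b

open Polynomial in
lemma kacPoly_ode (r : ℂ) (a b : ℕ) :
    derivative (kacPoly r a b) + C (r ^ 2) * (((a + b : ℕ) : ℂ[X]) * (X * kacPoly r a b)
      - X ^ 2 * derivative (kacPoly r a b)) = C (((a : ℂ) - b) * r) * kacPoly r a b := by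
  have ha := aux_pow_deriv r a
  have hb := aux_pow_deriv (-r) b
  unfold kacPoly
  rw [derivative_mul]
  simp only [C_neg, C_mul, C_sub, C_pow, Nat.cast_add, map_natCast] at ha hb ⊢
  linear_combination (1 + -C r * X) ^ b * (1 - C r * X) * ha
    + (1 + C r * X) ^ a * (1 + C r * X) * hb

open Polynomial in
lemma kacPoly_natDegree (r : ℂ) (a b : ℕ) : (kacPoly r a b).natDegree ≤ a + b := by
  unfold kacPoly
  have h : ∀ (r : ℂ) (a : ℕ), ((1 + C r * X : ℂ[X]) ^ a).natDegree ≤ a := by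
    intro r a
    have : (1 + C r * X : ℂ[X]).natDegree ≤ 1 := by compute_degree
    simpa using natDegree_pow_le_of_le a this
  exact natDegree_mul_le_of_le (h _ _) (h _ _)

lemma kacPoly_coeff_zero (r : ℂ) (a b : ℕ) : (kacPoly r a b).coeff 0 = 1 := by
  simp [kacPoly, Polynomial.coeff_zero_eq_eval_zero]

open Polynomial in
lemma kac_mulVec (n : ℕ) (r : ℂ) (a b : ℕ) (hab : a + b + 1 = n) :
    (kacM ℂ n (r ^ 2)) *ᵥ (fun j : Fin n => (kacPoly r a b).coeff j)
      = fun j : Fin n => ((a : ℂ) - b) * r * (kacPoly r a b).coeff j := by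
  funext i
  obtain ⟨i, hi⟩ := i
  set f := kacPoly r a b with hf
  have hode := congrArg (fun p => p.coeff i) (kacPoly_ode r a b)
  rw [← hf] at hode
  have hdeg : f.coeff n = 0 := coeff_eq_zero_of_natDegree_lt
    (lt_of_le_of_lt (kacPoly_natDegree r a b) (by omega))
  simp only [coeff_add, coeff_C_mul, coeff_sub, coeff_natCast_mul, coeff_derivative] at hode
  simp only [Matrix.mulVec, dotProduct, kacM, Matrix.of_apply]
  rw [← hode, Fin.sum_univ_eq_sum_range (fun j => (if i = j + 1 then ((n - 1 - j : ℕ) : ℂ) * r ^ 2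
    else if j = i + 1 then ((i + 1 : ℕ) : ℂ) else 0) * f.coeff j) n]
  have hsplit : ∀ j, (if i = j + 1 then ((n - 1 - j : ℕ) : ℂ) * r ^ 2
    else if j = i + 1 then ((i + 1 : ℕ) : ℂ) else 0) * f.coeff j =
    (if i = j + 1 then ((n - 1 - j : ℕ) : ℂ) * r ^ 2 * f.coeff j else 0)
    + (if j = i + 1 then ((i + 1 : ℕ) : ℂ) * f.coeff j else 0) := by
    intro j
    split_ifs <;> first | omega | simp
  simp only [hsplit, Finset.sum_add_distrib]
  have h2 : ∑ j ∈ Finset.range n, (if j = i + 1 then ((i + 1 : ℕ) : ℂ) * f.coeff j else 0)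
      = f.coeff (i + 1) * ((i : ℂ) + 1) := by
    rw [Finset.sum_ite_eq']
    by_cases h : i + 1 < n
    · simp [h]; ring
    · have : i + 1 = n := by omega
      simp [this, hdeg]
  rw [h2]
  cases i with
  | zero => simp [coeff_zero_eq_eval_zero]
  | succ m =>
    simp only [add_left_inj]
    rw [Finset.sum_ite_eq, coeff_X_mul, if_pos (by simp; omega)]
    have e : ((n - 1 - m : ℕ) : ℂ) = (a + b : ℕ) - (m : ℂ) := by
      rw [← Nat.cast_sub (by omega)]; congr 1; omega
    rw [e]
    cases m with
    | zero => simp [coeff_X_pow_mul']; ring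
    | succ l =>
      rw [show l + 1 + 1 = l + 2 from rfl, coeff_X_pow_mul, coeff_derivative]
      push_cast; ring

/-- block vector -/
def blockVec {n1 n2 : ℕ} (w : Fin n2 → ℂ) (u : ℕ) : Fin n1 × Fin n2 → ℂ :=
  fun p => if (p.1 : ℕ) = u then w p.2 else 0

lemma kac2_mulVec (N n : ℕ) (y lam : ℂ) (w : Fin n → ℂ)
    (hw : kacM ℂ n y *ᵥ w = fun j => lam * w j) (u : ℕ) (hu : u < N) :
    kac2M ℂ N n 0 y *ᵥ (blockVec w u) = lam • blockVec w u + (u : ℂ) • blockVec w (u - 1) := by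
  funext p
  obtain ⟨p, i⟩ := p
  simp only [Matrix.mulVec, dotProduct, kac2M, Matrix.of_apply, blockVec, Fintype.sum_prod_type,
    Pi.add_apply, Pi.smul_apply, smul_eq_mul]
  rw [Finset.sum_eq_single (⟨u, hu⟩ : Fin N)]
  · have hwi := congrFun hw i
    simp only [Matrix.mulVec, dotProduct] at hwi
    by_cases h : (p : ℕ) = u
    · have h' : p = ⟨u, hu⟩ := Fin.ext h
      subst h'
      simp only [if_true, hwi]
      rcases Nat.eq_zero_or_pos u with h0 | h0
      · simp [h0]
      · simp [show u ≠ u - 1 by omega]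
    · have h' : p ≠ ⟨u, hu⟩ := fun e => h (by rw [e])
      by_cases h3 : u = (p : ℕ) + 1
      · subst h3
        have h5 : (p : ℕ) ≠ p + 1 + 1 := by omega
        simp [h', h5]
      · have h4 : (p : ℕ) ≠ u - 1 ∨ u = 0 := by omega
        rcases h4 with h4 | h4
        · simp [h', h, h3, h4]
        · subst h4
          simp [h', h]
  · intro q _ hq
    have : (q : ℕ) ≠ u := fun e => hq (Fin.ext e)
    simp [this]
  · simp

open Polynomial in
lemma pairing (N n : ℕ) (hn : 0 < n) (y lam : ℂ) (w : Fin n → ℂ) (hw0 : w ⟨0, hn⟩ = 1)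
    (hw : kacM ℂ n y *ᵥ w = fun j => lam * w j) (k : ℕ) : ∀ (u : ℕ) (_ : u < N)
    (e : Fin N × Fin n → ℂ) (_ : e = fun p => if (p.1 : ℕ) = 0 ∧ (p.2 : ℕ) = 0 then 1 else 0),
    e ⬝ᵥ (kac2M ℂ N n 0 y ^ k *ᵥ blockVec w u) = (derivative^[u] (X ^ k : ℂ[X])).eval lam := by
  induction k with
  | zero =>
    intro u hu e he
    subst he
    rw [pow_zero, Matrix.one_mulVec, dotProduct, Finset.sum_eq_single (⟨0, by omega⟩, ⟨0, hn⟩)]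
    · cases u with
      | zero => simp [blockVec, hw0]
      | succ u => simp [blockVec, Polynomial.iterate_derivative_one]
    · rintro ⟨⟨a, ha⟩, ⟨b, hb⟩⟩ _ h
      have : ¬ (a = 0 ∧ b = 0) := by
        rintro ⟨rfl, rfl⟩; exact h rfl
      simp [this]
    · simp
  | succ k ih =>
    intro u hu e he
    rw [pow_succ, ← Matrix.mulVec_mulVec, kac2_mulVec N n y lam w hw u hu, Matrix.mulVec_add,
      Matrix.mulVec_smul, Matrix.mulVec_smul, dotProduct_add, dotProduct_smul, dotProduct_smul,
      ih u hu e he, ih (u - 1) (by omega) e he, pow_succ, iterate_derivative_mul_X]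
    simp [mul_comm]

open Polynomial in
lemma poly_zero_s17 (N n s : ℕ) (p : ℂ[X]) (lam : Fin n → ℂ) (hinj : Function.Injective lam)
    (h0 : ∀ b, lam b ≠ 0) (hdeg : p.degree < ((N * n : ℕ) : WithBot ℕ))
    (hroot : ∀ b, ∀ u < N, (derivative^[u] (X ^ s * p)).eval (lam b) = 0) : p = 0 := by
  by_contra hp
  have hg : X ^ s * p ≠ 0 := mul_ne_zero (pow_ne_zero _ X_ne_zero) hp
  have hd : ∀ b, (X - C (lam b)) ^ N ∣ p := by
    intro b
    rcases Nat.eq_zero_or_pos N with hN | hN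
    · simp [hN]
    have h := lt_rootMultiplicity_of_isRoot_iterate_derivative (n := N - 1) (t := lam b) hg
      (fun m hm => hroot b m (by omega))
    have h' : (X - C (lam b)) ^ N ∣ X ^ s * p :=
      (le_rootMultiplicity_iff hg).1 (by omega)
    have hc : IsCoprime (X - C (lam b)) (X : ℂ[X]) := by
      have := isCoprime_X_sub_C_of_isUnit_sub (R := ℂ) (a := lam b) (b := 0)
        (by simpa using h0 b)
      simpa using this
    exact (hc.pow (m := N) (n := s)).dvd_of_dvd_mul_left h'
  have hprod : ∏ b : Fin n, (X - C (lam b)) ^ N ∣ p := by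
    apply Finset.prod_dvd_of_coprime
    · intro i _ j _ hij
      exact (pairwise_coprime_X_sub_C hinj hij).pow
    · intro i _; exact hd i
  have := degree_le_of_dvd hprod hp
  rw [degree_prod] at this
  simp only [degree_pow, degree_X_sub_C, Finset.sum_const, Finset.card_univ, Fintype.card_fin] at this
  have h2 := lt_of_le_of_lt this hdeg
  simp only [nsmul_eq_mul, mul_one] at h2
  rw [← Nat.cast_mul, mul_comm] at h2
  exact lt_irrefl _ h2

lemma kac2M_map_s17 (N n : ℕ) (y : ℝ) :
    (kac2M ℝ N n 0 y).map (algebraMap ℝ ℂ) = kac2M ℂ N n 0 (y : ℂ) := by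
  ext p q
  simp only [kac2M, kacM, Matrix.map_apply, Matrix.of_apply]
  split_ifs <;> simp

/-- For `n1, n2 ≥ 2` with `n2` even, `τ ≠ 0` real, and
`Q = K(n1+1,n2,0,τ)`, the `(n1+1)n2` row vectors `e1·Q^s, …, e1·Q^{s+(n1+1)n2-1}` are
linearly independent for every `s ≥ 1`. -/
theorem rows_linearIndependent_flat_even (n1 n2 : ℕ) (h1 : 2 ≤ n1) (h2 : 2 ≤ n2)
    (he : Even n2) (τ : ℝ) (hτ : τ ≠ 0) (s : ℕ) (hs : 1 ≤ s) :
    LinearIndependent ℝ (fun k : Fin ((n1 + 1) * n2) =>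
      Matrix.vecMul (e1p (n1 + 1) n2) (kac2M ℝ (n1 + 1) n2 0 τ ^ (s + (k : ℕ)))) := by
  classical
  obtain ⟨r, hr⟩ := IsAlgClosed.exists_pow_nat_eq (τ : ℂ) (n := 2) (by norm_num)
  have hr0 : r ≠ 0 := by
    rintro rfl
    apply hτ
    have : (τ : ℂ) = 0 := by rw [← hr]; simp
    exact_mod_cast this
  rw [Fintype.linearIndependent_iff]
  intro c hc
  set p : Polynomial ℂ := ∑ k : Fin ((n1 + 1) * n2),
    Polynomial.C ((c k : ℝ) : ℂ) * Polynomial.X ^ (k : ℕ) with hp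
  have hp0 : p = 0 := by
    refine poly_zero_s17 (n1 + 1) n2 s p
      (fun b => (((n2 - 1 - (b : ℕ) : ℕ) : ℂ) - ((b : ℕ) : ℂ)) * r) ?_ ?_ ?_ ?_
    · intro b b' h
      have h := mul_right_cancel₀ hr0 h
      have hb := b.2
      have hb' := b'.2
      have h3 : (n2 - 1 - (b : ℕ)) + (b' : ℕ) = (n2 - 1 - (b' : ℕ)) + (b : ℕ) := by
        have : (((n2 - 1 - (b : ℕ) : ℕ) : ℂ)) + (b' : ℕ) = ((n2 - 1 - (b' : ℕ) : ℕ) : ℂ) + (b : ℕ) := by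
          linear_combination h
        exact_mod_cast this
      apply Fin.ext
      omega
    · intro b h
      have hb := b.2
      rcases mul_eq_zero.1 h with h | h
      · have : (n2 - 1 - (b : ℕ)) = (b : ℕ) := by exact_mod_cast sub_eq_zero.1 h
        obtain ⟨m, hm⟩ := he
        omega
      · exact hr0 h
    · refine lt_of_le_of_lt (Polynomial.degree_sum_le _ _) ?_
      rw [Finset.sup_lt_iff (WithBot.bot_lt_coe _)]
      intro k _
      refine lt_of_le_of_lt (Polynomial.degree_C_mul_X_pow_le _ _) ?_
      exact_mod_cast k.2
    · intro b u hu
      have hb := b.2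
      have hw := kac_mulVec n2 r (n2 - 1 - (b : ℕ)) b (by omega)
      have key := fun k => pairing (n1 + 1) n2 (by omega) (r ^ 2) _ _
        (kacPoly_coeff_zero r (n2 - 1 - (b : ℕ)) b) hw k u hu _ rfl
      rw [hp, Finset.mul_sum, Polynomial.iterate_derivative_sum, Polynomial.eval_finsetSum]
      set W : Fin (n1 + 1) × Fin n2 → ℂ := blockVec
        (fun j : Fin n2 => (kacPoly r (n2 - 1 - (b : ℕ)) b).coeff j) u with hW
      have hcC : ∑ k : Fin ((n1 + 1) * n2), ((c k : ℝ) : ℂ) •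
          Matrix.vecMul (fun p : Fin (n1 + 1) × Fin n2 =>
            if (p.1 : ℕ) = 0 ∧ (p.2 : ℕ) = 0 then (1 : ℂ) else 0)
          (kac2M ℂ (n1 + 1) n2 0 (r ^ 2) ^ (s + (k : ℕ))) = 0 := by
        funext q
        have := congrArg (algebraMap ℝ ℂ) (congrFun hc q)
        simp only [Finset.sum_apply, Pi.smul_apply, smul_eq_mul, Pi.zero_apply, map_sum, map_mul,
          map_zero] at this ⊢
        refine Eq.trans ?_ this
        refine Finset.sum_congr rfl fun k _ => ?_
        rw [RingHom.map_vecMul, hr, ← kac2M_map_s17, ← Matrix.map_pow]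
        congr 2
        funext p
        simp only [e1p, Function.comp]
        split_ifs <;> simp
      have h5 := congrArg (fun v => v ⬝ᵥ W) hcC
      simp only [sum_dotProduct, smul_dotProduct, zero_dotProduct, ← Matrix.dotProduct_mulVec,
        key] at h5
      rw [← h5]
      refine Finset.sum_congr rfl fun k _ => ?_
      rw [mul_left_comm, ← pow_add, Polynomial.iterate_derivative_C_mul]
      simp
  intro k
  have := congrArg (fun q => q.coeff (k : ℕ)) hp0
  simp only [hp, Polynomial.finsetSum_coeff, Polynomial.coeff_C_mul_X_pow, Polynomial.coeff_zero] at this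
  rw [Finset.sum_eq_single k] at this
  · simpa using this
  · intro j _ hj
    rw [if_neg]
    exact fun e => hj (Fin.ext e.symm)
  · simp
end
end

section
/- Let n1, n2 ≥ 2 be integers with n2 odd, let τ be a nonzero real number, and set Q = K(n1+1,n2,0,τ) and let e1 be the first standard basis row vector of ℝ^{(n1+1)n2}. Then the family of row vectors Λ = {e1·Q^2, e1·Q^3, …, e1·Q^{(n1+1)n2−1}} is linearly independent, whereas for every integer s ≥ (n1+1)n2 the family Λ ∪ {e1·Q^s} is linearly dependent. -/
open Matrix Kronecker

noncomputable section

open Polynomial in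
theorem kac_eig {F : Type*} [Field F] (m : ℕ) (τ l : F) (g : F[X])
    (hd : g.natDegree + 1 ≤ m)
    (hg : derivative g + C τ * (X * (C ((m - 1 : ℕ) : F) * g - X * derivative g)) = C l * g) :
    kacM F m τ *ᵥ (fun i => g.coeff (i : ℕ)) = l • (fun i : Fin m => g.coeff (i : ℕ)) := by
  funext i
  obtain ⟨i, hi⟩ := i
  have h := congrArg (fun p => coeff p i) hg
  simp only [coeff_add, coeff_C_mul, coeff_derivative] at h
  simp only [Matrix.mulVec, dotProduct, kacM, Matrix.of_apply, Pi.smul_apply, smul_eq_mul]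
  rw [← h, Fin.sum_univ_eq_sum_range
    (fun j => (if i = j + 1 then ((m - 1 - j : ℕ) : F) * τ else if j = i + 1 then
      ((i + 1 : ℕ) : F) else 0) * g.coeff j) m]
  have e : ∀ j ∈ Finset.range m, (if i = j + 1 then ((m - 1 - j : ℕ) : F) * τ else if j = i + 1 then
      ((i + 1 : ℕ) : F) else 0) * g.coeff j =
      (if i = j + 1 then ((m - 1 - j : ℕ) : F) * τ * g.coeff j else 0) +
      (if j = i + 1 then ((i + 1 : ℕ) : F) * g.coeff j else 0) := by
    intro j _
    by_cases h1 : i = j + 1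
    · have : ¬ j = i + 1 := by omega
      simp [h1]
      omega
    · rw [if_neg h1, if_neg h1, zero_add, ite_mul, zero_mul]
  rw [Finset.sum_congr rfl e, Finset.sum_add_distrib]
  have e2 : (∑ j ∈ Finset.range m, if j = i + 1 then ((i + 1 : ℕ) : F) * g.coeff j else 0)
      = g.coeff (i + 1) * (i + 1) := by
    rw [Finset.sum_ite_eq']
    split_ifs with hh
    · push_cast; ring
    · rw [Finset.mem_range] at hh
      rw [coeff_eq_zero_of_natDegree_lt (by omega)]; simp
  rw [e2, add_comm]
  congr 1
  cases i with
  | zero => simp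
  | succ k =>
    have : ∀ j, (k + 1 = j + 1) ↔ (k = j) := by intro j; omega
    simp only [this]
    rw [Finset.sum_ite_eq, if_pos (Finset.mem_range.2 (by omega)), coeff_X_mul, coeff_sub,
      coeff_C_mul]
    have e3 : (X * derivative g).coeff k = k * g.coeff k := by
      cases k with
      | zero => simp
      | succ k => rw [coeff_X_mul, coeff_derivative]; push_cast; ring
    rw [e3, Nat.cast_sub (by omega)]
    ring

def Wv {F : Type*} [Field F] (N m : ℕ) (w : Fin m → F) (j : ℕ) : Fin N × Fin m → F :=
  fun q => if (q.1 : ℕ) = j then w q.2 else 0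

theorem kac2_W {F : Type*} [Field F] (N m : ℕ) (τ l : F) (w : Fin m → F)
    (hw : kacM F m τ *ᵥ w = l • w) (j : ℕ) (hj : j < N) :
    kac2M F N m 0 τ *ᵥ Wv N m w j = l • Wv N m w j + (j : F) • Wv N m w (j - 1) := by
  funext p
  obtain ⟨u, v⟩ := p
  simp only [Matrix.mulVec, dotProduct, Fintype.sum_prod_type]
  rw [Finset.sum_eq_single (⟨j, hj⟩ : Fin N)]
  · have hv := congrFun hw v
    simp only [Matrix.mulVec, dotProduct, Pi.smul_apply, smul_eq_mul] at hv
    simp only [Wv, kac2M, Matrix.of_apply, Pi.add_apply, Pi.smul_apply, smul_eq_mul, if_true,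
      mul_zero, ite_self]
    by_cases h1 : (u : ℕ) = j
    · have : u = ⟨j, hj⟩ := Fin.ext h1
      simp only [this, if_true, hv]
      by_cases h0 : j = 0
      · simp [h0]
      · have : ¬ j = j - 1 := by omega
        simp [this]
    · have h1' : ¬ u = ⟨j, hj⟩ := fun h => h1 (congrArg Fin.val h)
      simp only [h1, h1', if_false]
      by_cases h2 : j = u + 1
      · have h3 : (u : ℕ) = j - 1 := by omega
        have h4 : ¬ ((u : ℕ) = j + 1) := by omega
        simp only [h4, if_false, if_pos h2, if_pos h3, ite_mul, zero_mul,
          Finset.sum_ite_eq, Finset.mem_univ, if_true]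
        rw [h2]; simp
      · simp only [h2, if_false, ite_self, zero_mul, Finset.sum_const_zero]
        by_cases h0 : j = 0
        · simp [h0]
        · have : ¬ (u : ℕ) = j - 1 := by omega
          simp [this]
  · intro b _ hb
    have : ¬ (b : ℕ) = j := fun h => hb (Fin.ext h)
    simp [Wv, this]
  · simp

/-- the pairing of a real vector with a vector over `F` -/
def pr {F ι : Type*} [Field F] [Algebra ℝ F] [Fintype ι] (W : ι → F) : (ι → ℝ) →ₗ[ℝ] F where
  toFun v := ∑ q, v q • W q
  map_add' := by intro a b; simp [add_smul, Finset.sum_add_distrib]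
  map_smul' := by intro a b; simp [mul_smul, Finset.smul_sum]

theorem pr_vecMul {F ι : Type*} [Field F] [Algebra ℝ F] [Fintype ι] (W : ι → F) (v : ι → ℝ)
    (Q : Matrix ι ι ℝ) : pr W (v ᵥ* Q) = pr (Q.map (algebraMap ℝ F) *ᵥ W) v := by
  simp only [pr, LinearMap.coe_mk, AddHom.coe_mk, Matrix.vecMul, Matrix.mulVec, dotProduct,
    Finset.sum_smul, Finset.smul_sum, Matrix.map_apply]
  rw [Finset.sum_comm]
  simp [mul_smul, Algebra.smul_def, mul_assoc]

theorem kac2_map {F : Type*} [Field F] [Algebra ℝ F] (N m : ℕ) (τ : ℝ) :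
    (kac2M ℝ N m 0 τ).map (algebraMap ℝ F) = kac2M F N m 0 (algebraMap ℝ F τ) := by
  ext p q
  simp only [Matrix.map_apply, kac2M, kacM, Matrix.of_apply]
  split_ifs <;> simp

theorem pr_lin {F ι : Type*} [Field F] [Algebra ℝ F] [Fintype ι] (W W' : ι → F) (a b : F)
    (v : ι → ℝ) : pr (a • W + b • W') v = a * pr W v + b * pr W' v := by
  simp only [pr, LinearMap.coe_mk, AddHom.coe_mk, Finset.mul_sum, ← Finset.sum_add_distrib]
  refine Finset.sum_congr rfl fun q _ => ?_
  simp [Algebra.smul_def]; ring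

open Polynomial in
theorem deriv_X_rec {F : Type*} [Field F] (l : F) (k j : ℕ) :
    (derivative^[j] (X ^ (k + 1) : F[X])).eval l =
      l * (derivative^[j] (X ^ k : F[X])).eval l
        + j * (derivative^[j - 1] (X ^ k : F[X])).eval l := by
  have : ∀ j (p : F[X]), derivative^[j] (X * p) =
      X * derivative^[j] p + (j : F[X]) * derivative^[j - 1] p := by
    intro j p
    induction j with
    | zero => simp
    | succ j ih =>
      rw [Function.iterate_succ_apply', ih]
      cases j with
      | zero => simp; ring
      | succ j =>
        simp only [Nat.add_sub_cancel, Function.iterate_succ_apply', derivative_add,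
          derivative_mul, derivative_X, derivative_natCast]
        push_cast; ring
  rw [pow_succ', this]; simp

open Polynomial in
theorem pr_pow {F : Type*} [Field F] [Algebra ℝ F] (N m : ℕ) (hN : 0 < N) (hm : 0 < m)
    (τ : ℝ) (l : F) (w : Fin m → F)
    (hw : kacM F m (algebraMap ℝ F τ) *ᵥ w = l • w) (hw0 : w ⟨0, hm⟩ = 1) (k : ℕ) :
    ∀ j, j < N → pr (Wv N m w j) (e1p N m ᵥ* (kac2M ℝ N m 0 τ ^ k)) =
      (derivative^[j] (X ^ k : F[X])).eval l := by
  induction k with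
  | zero =>
    intro j hj
    simp only [pow_zero, Matrix.vecMul_one, pr, LinearMap.coe_mk, AddHom.coe_mk]
    rw [Finset.sum_eq_single (⟨0, hN⟩, ⟨0, hm⟩)]
    · cases j with
      | zero => simp [e1p, Wv, hw0]
      | succ j => simp [e1p, Wv]
    · rintro ⟨a, b⟩ _ hb
      have : ¬ ((a : ℕ) = 0 ∧ (b : ℕ) = 0) := by
        rintro ⟨h1, h2⟩
        exact hb (Prod.ext (Fin.ext h1) (Fin.ext h2))
      simp only [e1p, this, if_false, zero_smul]
    · simp
  | succ k ih =>
    intro j hj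
    rw [pow_succ, ← Matrix.vecMul_vecMul, pr_vecMul, kac2_map, kac2_W N m _ l w hw j hj, pr_lin,
      ih j hj, ih (j - 1) (by omega), deriv_X_rec]

open Polynomial in
theorem ode_one {F : Type*} [Field F] (s : F) (a b : ℕ) :
    derivative ((1 + C s * X) ^ a * (1 - C s * X) ^ b : F[X]) + C (s ^ 2) *
      (X * (C ((a + b : ℕ) : F) * ((1 + C s * X) ^ a * (1 - C s * X) ^ b)
        - X * derivative ((1 + C s * X) ^ a * (1 - C s * X) ^ b))) =
      C (((a : F) - b) * s) * ((1 + C s * X) ^ a * (1 - C s * X) ^ b) := by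
  have h : ∀ (f : F[X]) (n : ℕ), f * derivative (f ^ n) = (n : F[X]) * derivative f * f ^ n := by
    intro f n
    cases n with
    | zero => simp
    | succ n => rw [derivative_pow]; simp; ring
  have h1 := h (1 + C s * X) a
  have h2 := h (1 - C s * X) b
  simp only [derivative_add, derivative_sub, derivative_one, derivative_C_mul, derivative_X,
    mul_one, zero_add, zero_sub] at h1 h2
  rw [derivative_mul]
  simp only [map_mul, map_sub, map_pow, map_natCast]
  push_cast
  linear_combination (1 - C s * X) ^ (b + 1) * h1 + (1 + C s * X) ^ (a + 1) * h2

open Polynomial in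
theorem ode_two {F : Type*} [Field F] (t : F) (h : ℕ) :
    derivative ((1 - C t * X ^ 2) ^ h : F[X]) + C t *
      (X * (C ((2 * h : ℕ) : F) * ((1 - C t * X ^ 2) ^ h)
        - X * derivative ((1 - C t * X ^ 2) ^ h))) = C 0 * (1 - C t * X ^ 2) ^ h := by
  cases h with
  | zero => simp
  | succ n =>
    rw [derivative_pow]
    have : (C 2 : F[X]) = 2 := rfl
    simp [this]
    ring

open Polynomial in
theorem poly_zero_s18 {F : Type*} [Field F] [CharZero F] (N m : ℕ) (lam : Fin m → F)
    (hl : Function.Injective lam) (p : F[X])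
    (hp : ∀ a j, j < N → (derivative^[j] p).eval (lam a) = 0) (hd : p.degree < (N * m : ℕ)) :
    p = 0 := by
  by_contra h0
  have h1 : ∀ a, (X - C (lam a)) ^ N ∣ p := by
    intro a
    rw [← le_rootMultiplicity_iff h0]
    rcases N with _ | n
    · simp
    · exact Polynomial.lt_rootMultiplicity_of_isRoot_iterate_derivative h0
        (fun j hj => hp a j (by omega))
  have h2 : (∏ a : Fin m, (X - C (lam a)) ^ N) ∣ p := by
    apply Finset.prod_dvd_of_coprime
    · intro a _ b _ hab
      exact (Polynomial.isCoprime_X_sub_C_of_isUnit_sub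
        (sub_ne_zero.2 (fun h => hab (hl h))).isUnit).pow
    · intro a _; exact h1 a
  have h3 := degree_le_of_dvd h2 h0
  rw [degree_prod] at h3
  simp only [degree_pow, degree_X_sub_C, Finset.sum_const, Finset.card_univ, Fintype.card_fin] at h3
  have : ((N * m : ℕ) : WithBot ℕ) ≤ p.degree := by
    refine le_trans (le_of_eq ?_) h3
    simp [mul_comm]
  exact absurd hd (not_lt.2 this)

/-- For `n1, n2 ≥ 2` with `n2` odd, `τ ≠ 0` real, and
`Q = K(n1+1,n2,0,τ)`, the family `Λ = {e1·Q^2, e1·Q^3, …, e1·Q^{(n1+1)n2-1}}` is linearly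
independent, whereas for every `s ≥ (n1+1)n2` the family `Λ ∪ {e1·Q^s}` is linearly
dependent. -/
theorem rows_linearIndependent_flat_odd (n1 n2 : ℕ) (h1 : 2 ≤ n1) (h2 : 2 ≤ n2)
    (ho : Odd n2) (τ : ℝ) (hτ : τ ≠ 0) :
    LinearIndependent ℝ (fun k : Fin ((n1 + 1) * n2 - 2) =>
        Matrix.vecMul (e1p (n1 + 1) n2) (kac2M ℝ (n1 + 1) n2 0 τ ^ ((k : ℕ) + 2))) ∧
      ∀ s : ℕ, (n1 + 1) * n2 ≤ s →
        ¬ LinearIndependent ℝ (Sum.elim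
          (fun k : Fin ((n1 + 1) * n2 - 2) =>
            Matrix.vecMul (e1p (n1 + 1) n2) (kac2M ℝ (n1 + 1) n2 0 τ ^ ((k : ℕ) + 2)))
          (fun _ : Unit =>
            Matrix.vecMul (e1p (n1 + 1) n2) (kac2M ℝ (n1 + 1) n2 0 τ ^ s))) := by
  have hm : 0 < n2 := by omega
  have hN : 0 < n1 + 1 := by omega
  constructor
  · rw [Fintype.linearIndependent_iff]
    intro c hc
    obtain ⟨s, hs⟩ : ∃ s : ℂ, s ^ 2 = (τ : ℂ) := IsAlgClosed.exists_pow_nat_eq _ (by norm_num)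
    have hs0 : s ≠ 0 := by
      rintro rfl
      apply hτ
      have : (τ : ℂ) = 0 := by rw [← hs]; norm_num
      exact_mod_cast this
    let p : Polynomial ℂ := ∑ k : Fin ((n1 + 1) * n2 - 2),
      Polynomial.C (c k : ℂ) * Polynomial.X ^ ((k : ℕ) + 2)
    have hp : p = 0 := by
      apply poly_zero_s18 (n1 + 1) n2
        (fun a : Fin n2 => (((a : ℕ) : ℂ) - ((n2 - 1 - (a : ℕ) : ℕ) : ℂ)) * s)
      · intro a b hab
        have h := mul_right_cancel₀ hs0 hab
        rw [sub_eq_sub_iff_add_eq_add] at h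
        have h' : (a : ℕ) + (n2 - 1 - (b : ℕ)) = (b : ℕ) + (n2 - 1 - (a : ℕ)) := by exact_mod_cast h
        apply Fin.ext
        omega
      · intro a j hj
        have hab : (a : ℕ) + (n2 - 1 - (a : ℕ)) = n2 - 1 := by omega
        have hode := ode_one s (a : ℕ) (n2 - 1 - (a : ℕ))
        rw [hab, hs] at hode
        have heig := kac_eig n2 (τ : ℂ) _ _ (by
          have : ((1 + Polynomial.C s * Polynomial.X) ^ (a : ℕ) *
              (1 - Polynomial.C s * Polynomial.X) ^ (n2 - 1 - (a : ℕ))).natDegree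
                ≤ (a : ℕ) * 1 + (n2 - 1 - (a : ℕ)) * 1 := by
            refine Polynomial.natDegree_mul_le_of_le ?_ ?_ <;>
            · refine Polynomial.natDegree_pow_le_of_le _ ?_
              compute_degree
          omega) hode
        have hpow := fun k => pr_pow (F := ℂ) (n1 + 1) n2 hN hm τ _ _ heig
          (by simp [Polynomial.coeff_zero_eq_eval_zero]) k j hj
        have h := congrArg (pr (F := ℂ) (Wv (n1 + 1) n2 (fun i : Fin n2 =>
          ((1 + Polynomial.C s * Polynomial.X) ^ (a : ℕ) *
              (1 - Polynomial.C s * Polynomial.X) ^ (n2 - 1 - (a : ℕ))).coeff (i : ℕ)) j)) hc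
        simp only [map_sum, map_smul, map_zero] at h
        rw [Finset.sum_congr rfl (fun k _ => by rw [hpow])] at h
        simp only [p, Polynomial.iterate_derivative_sum, Polynomial.iterate_derivative_C_mul,
          Polynomial.eval_finset_sum, Polynomial.eval_mul, Polynomial.eval_C]
        simpa using h
      · refine lt_of_le_of_lt (Polynomial.degree_sum_le _ _) ?_
        rw [Finset.sup_lt_iff (WithBot.bot_lt_coe _)]
        intro k _
        refine lt_of_le_of_lt (Polynomial.degree_C_mul_X_pow_le _ _) ?_
        have := k.2
        exact_mod_cast (by omega : (k : ℕ) + 2 < (n1 + 1) * n2)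
    intro k
    have h := congrArg (fun q => Polynomial.coeff q ((k : ℕ) + 2)) hp
    simp only [p, Polynomial.finsetSum_coeff, Polynomial.coeff_C_mul_X_pow,
      Polynomial.coeff_zero] at h
    rw [Finset.sum_eq_single k] at h
    · simpa using h
    · intro b _ hb
      rw [if_neg]
      intro h'
      exact hb (Fin.ext (by omega))
    · simp
  · intro s hs hli
    obtain ⟨h, hh⟩ := ho
    have hsz : 6 ≤ (n1 + 1) * n2 := Nat.mul_le_mul (by omega : 3 ≤ n1 + 1) h2
    have heig := kac_eig n2 τ 0 ((1 - Polynomial.C τ * Polynomial.X ^ 2) ^ h) (by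
      have : ((1 - Polynomial.C τ * Polynomial.X ^ 2) ^ h : Polynomial ℝ).natDegree ≤ h * 2 := by
        refine Polynomial.natDegree_pow_le_of_le _ ?_
        compute_degree
      omega) (by
      have := ode_two τ h
      rwa [show 2 * h = n2 - 1 by omega] at this)
    have hpow := pr_pow (F := ℝ) (n1 + 1) n2 hN hm τ _ _ heig
          (by simp [Polynomial.coeff_zero_eq_eval_zero])
    generalize (fun i : Fin n2 => ((1 - Polynomial.C τ * Polynomial.X ^ 2) ^ h
      : Polynomial ℝ).coeff (i : ℕ)) = w at hpow
    let L : (Fin (n1 + 1) × Fin n2 → ℝ) →ₗ[ℝ] ℝ × ℝ :=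
      (pr (Wv (n1 + 1) n2 w 0)).prod (pr (Wv (n1 + 1) n2 w 1))
    have hL : ∀ k, L (e1p (n1 + 1) n2 ᵥ* (kac2M ℝ (n1 + 1) n2 0 τ ^ k)) =
        ((Polynomial.X ^ k : Polynomial ℝ).eval 0,
         (Polynomial.derivative (Polynomial.X ^ k : Polynomial ℝ)).eval 0) := by
      intro k
      have a0 := hpow k 0 (by omega)
      have a1 := hpow k 1 (by omega)
      simp only [Function.iterate_zero, id, Function.iterate_one] at a0 a1
      exact Prod.ext a0 a1
    have hker : ∀ k, 2 ≤ k →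
        e1p (n1 + 1) n2 ᵥ* (kac2M ℝ (n1 + 1) n2 0 τ ^ k) ∈ LinearMap.ker L := by
      intro k hk
      have : k - 1 ≠ 0 := by omega
      have : k ≠ 0 := by omega
      rw [LinearMap.mem_ker, hL]
      simp [Polynomial.derivative_X_pow, *]
    have hsurj : LinearMap.range L = ⊤ := by
      rw [LinearMap.range_eq_top]
      rintro ⟨a, b⟩
      refine ⟨a • (e1p (n1 + 1) n2 ᵥ* (kac2M ℝ (n1 + 1) n2 0 τ ^ 0)) +
        b • (e1p (n1 + 1) n2 ᵥ* (kac2M ℝ (n1 + 1) n2 0 τ ^ 1)), ?_⟩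
      rw [map_add, map_smul, map_smul, hL, hL]
      simp
    have hfr := LinearMap.finrank_range_add_finrank_ker L
    rw [hsurj, finrank_top] at hfr
    simp only [Module.finrank_prod, Module.finrank_self, Module.finrank_fintype_fun_eq_card,
      Fintype.card_prod, Fintype.card_fin] at hfr
    have hsub : Submodule.span ℝ (Set.range (Sum.elim
          (fun k : Fin ((n1 + 1) * n2 - 2) =>
            Matrix.vecMul (e1p (n1 + 1) n2) (kac2M ℝ (n1 + 1) n2 0 τ ^ ((k : ℕ) + 2)))
          (fun _ : Unit =>
            Matrix.vecMul (e1p (n1 + 1) n2) (kac2M ℝ (n1 + 1) n2 0 τ ^ s)))) ≤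
        LinearMap.ker L := by
      rw [Submodule.span_le]
      rintro _ ⟨k | k, rfl⟩
      · exact hker _ (by omega)
      · exact hker _ (by omega)
    have h3 := Submodule.finrank_mono hsub
    rw [finrank_span_eq_card hli] at h3
    simp only [Fintype.card_sum, Fintype.card_fin, Fintype.card_unit] at h3
    omega
end
end

section
/- Let n1, n2 ≥ 2 be integers such that (n1+1)n2 is even, and let τ ∈ ℝ. Write M = M(n1,n2,τ) = (m_{ij}). Then: (a) the family of odd-indexed rows of M is linearly dependent; (b) the family of columns C_j of M all of whose odd-indexed entries vanish is linearly dependent; in particular, det M = 0, i.e. M is a singular matrix. -/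
open Matrix Kronecker

noncomputable section

/-- `K(n1+1,n2,0,τ)` as a matrix indexed by `Fin ((n1+1)·n2)`, placing the pair `(u,v)`
at the 0-based position `u·n2 + v`. -/
def kac2FinFlat (n1 n2 : ℕ) (τ : ℝ) :
    Matrix (Fin ((n1 + 1) * n2)) (Fin ((n1 + 1) * n2)) ℝ :=
  Matrix.reindex finProdFinEquiv finProdFinEquiv (kac2M ℝ (n1 + 1) n2 0 τ)

/-- The `((n1+1)n2-1) × ((n1+1)n2)` matrix `M̄(n1,n2,τ)` whose `i`-th row (1-based) is
the row vector `e1·Q^{i+1}`, where `Q = K(n1+1,n2,0,τ)`. -/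
def MbarFlat (n1 n2 : ℕ) (τ : ℝ) :
    Matrix (Fin ((n1 + 1) * n2 - 1)) (Fin ((n1 + 1) * n2)) ℝ :=
  Matrix.of fun i j =>
    Matrix.vecMul (e1v ((n1 + 1) * n2)) (kac2FinFlat n1 n2 τ ^ ((i : ℕ) + 2)) j

/-- The square matrix `M(n1,n2,τ)` of order `(n1+1)n2-1` obtained from `M̄(n1,n2,τ)` by
deleting its first column. -/
def MmatFlat (n1 n2 : ℕ) (τ : ℝ) :
    Matrix (Fin ((n1 + 1) * n2 - 1)) (Fin ((n1 + 1) * n2 - 1)) ℝ :=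
  Matrix.of fun i j =>
    MbarFlat n1 n2 τ i ⟨(j : ℕ) + 1, by have := j.isLt; omega⟩


/-- A linearly independent family of functions supported on `P` has at most `#P` members. -/
lemma card_le_of_support {ι κ : Type*} [Fintype ι] [Fintype κ] (f : ι → κ → ℝ) (P : κ → Prop)
    [DecidablePred P] (hf : ∀ i k, ¬ P k → f i k = 0) (hl : LinearIndependent ℝ f) :
    Fintype.card ι ≤ Fintype.card {k // P k} := by
  have h : LinearIndependent ℝ (fun i => fun k : {k // P k} => f i k.1) := by
    rw [Fintype.linearIndependent_iff] at hl ⊢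
    intro g hg
    apply hl g
    funext k
    by_cases hk : P k
    · have := congrFun hg ⟨k, hk⟩
      simpa [Finset.sum_apply] using this
    · simp [Finset.sum_apply, hf _ k hk]
  have := h.fintype_card_le_finrank
  simpa using this

/-- Parity of a flat position. -/
def posPar {a b : ℕ} (p : Fin (a * b)) : ℕ :=
  (((finProdFinEquiv.symm p).1 : ℕ) + ((finProdFinEquiv.symm p).2 : ℕ)) % 2

lemma posPar_zero {a b : ℕ} (p : Fin (a * b)) (hp : (p : ℕ) = 0) : posPar p = 0 := by
  simp [posPar, finProdFinEquiv, Fin.divNat, Fin.modNat, hp]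

lemma kac2Fin_par (n1 n2 : ℕ) (τ : ℝ) (p q : Fin ((n1 + 1) * n2))
    (h : kac2FinFlat n1 n2 τ p q ≠ 0) : (posPar p + 1) % 2 = posPar q := by
  unfold kac2FinFlat kac2M kacM at h
  simp only [Matrix.reindex_apply, Matrix.submatrix_apply, Matrix.of_apply] at h
  unfold posPar
  generalize finProdFinEquiv.symm p = p' at *
  generalize finProdFinEquiv.symm q = q' at *
  obtain ⟨u, v⟩ := p'
  obtain ⟨u', v'⟩ := q'
  simp only [Fin.ext_iff] at h ⊢
  split_ifs at h <;> first | omega | exact absurd rfl h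

lemma vec_par (n1 n2 : ℕ) (τ : ℝ) (k : ℕ) : ∀ q : Fin ((n1 + 1) * n2), posPar q ≠ k % 2 →
    Matrix.vecMul (e1v ((n1 + 1) * n2)) (kac2FinFlat n1 n2 τ ^ k) q = 0 := by
  induction k with
  | zero =>
    intro q hq
    simp only [pow_zero, Matrix.vecMul_one, e1v]
    rw [if_neg]
    intro h
    exact hq (by simpa using posPar_zero q h)
  | succ k ih =>
    intro q hq
    rw [pow_succ, ← Matrix.vecMul_vecMul]
    simp only [Matrix.vecMul, dotProduct] at ih ⊢
    apply Finset.sum_eq_zero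
    intro p _
    by_cases hp : posPar p = k % 2
    · by_cases hz : kac2FinFlat n1 n2 τ p q = 0
      · rw [hz, mul_zero]
      · have := kac2Fin_par n1 n2 τ p q hz
        omega
    · rw [ih p hp, zero_mul]

lemma sum_sign (a b : ℕ) (he : Even (a * b)) :
    ∑ p : Fin (a * b), (-1 : ℤ) ^ posPar p = 0 := by
  have h : ∑ p : Fin (a * b), (-1 : ℤ) ^ posPar p
      = ∑ x : Fin a × Fin b, (-1 : ℤ) ^ (x.1 : ℕ) * (-1 : ℤ) ^ (x.2 : ℕ) := by
    rw [← finProdFinEquiv.symm.sum_comp]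
    refine Finset.sum_congr rfl fun p _ => ?_
    rw [posPar, ← neg_one_pow_eq_pow_mod_two, pow_add]
  rw [h, Fintype.sum_prod_type]
  dsimp only
  rw [← Fintype.sum_mul_sum,
    Fin.sum_univ_eq_sum_range (fun i => (-1 : ℤ) ^ i) a,
    Fin.sum_univ_eq_sum_range (fun i => (-1 : ℤ) ^ i) b, neg_one_geom_sum, neg_one_geom_sum]
  rcases Nat.even_mul.1 he with h | h <;> simp [h]

lemma card_par (a b : ℕ) (he : Even (a * b)) :
    Fintype.card {p : Fin (a * b) // posPar p = 0} = a * b / 2 ∧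
    Fintype.card {p : Fin (a * b) // posPar p = 1} = a * b / 2 := by
  have hlt : ∀ p : Fin (a * b), posPar p = 0 ∨ posPar p = 1 := fun p => by
    unfold posPar; omega
  have h1 : ∑ p : Fin (a * b), (-1 : ℤ) ^ posPar p
      = (Finset.univ.filter fun p : Fin (a * b) => posPar p = 0).card
        - (Finset.univ.filter fun p : Fin (a * b) => posPar p = 1).card := by
    rw [Finset.card_filter, Finset.card_filter]
    push_cast
    rw [← Finset.sum_sub_distrib]
    refine Finset.sum_congr rfl fun p _ => ?_
    rcases hlt p with h | h <;> simp [h]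
  have h2 : a * b = (Finset.univ.filter fun p : Fin (a * b) => posPar p = 0).card
        + (Finset.univ.filter fun p : Fin (a * b) => posPar p = 1).card := by
    rw [Finset.card_filter, Finset.card_filter, ← Finset.sum_add_distrib]
    rw [Finset.sum_congr rfl (g := fun _ => 1)]
    · simp
    · intro p _
      rcases hlt p with h | h <;> simp [h]
  rw [sum_sign a b he] at h1
  rw [Fintype.card_subtype, Fintype.card_subtype]
  omega

lemma Mmat_par (n1 n2 : ℕ) (τ : ℝ) (i j : Fin ((n1 + 1) * n2 - 1))
    (h : posPar (⟨(j : ℕ) + 1, by have := j.isLt; omega⟩ : Fin ((n1 + 1) * n2)) ≠ (i : ℕ) % 2) :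
    MmatFlat n1 n2 τ i j = 0 := by
  simp only [MmatFlat, MbarFlat, Matrix.of_apply]
  apply vec_par
  omega

/-- For `n1, n2 ≥ 2` with `(n1+1)n2` even and `τ ∈ ℝ`, writing
`M = M(n1,n2,τ) = (m_{ij})`: (a) the family of odd-indexed rows of `M` is linearly
dependent; (b) the family of columns of `M` all of whose odd-indexed entries vanish is
linearly dependent; in particular `det M = 0`.  (Row/column indices are 1-based in the
informal statement; the 0-based index `k` corresponds to the 1-based index `k+1`, so
"odd-indexed" means `k % 2 = 0`.) -/
theorem MmatFlat_singular (n1 n2 : ℕ) (h1 : 2 ≤ n1) (h2 : 2 ≤ n2)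
    (he : Even ((n1 + 1) * n2)) (τ : ℝ) :
    (¬ LinearIndependent ℝ
        (fun i : {i : Fin ((n1 + 1) * n2 - 1) // (i : ℕ) % 2 = 0} =>
          MmatFlat n1 n2 τ i.1)) ∧
      (¬ LinearIndependent ℝ
        (fun j : {j : Fin ((n1 + 1) * n2 - 1) //
            ∀ i : Fin ((n1 + 1) * n2 - 1), (i : ℕ) % 2 = 0 → MmatFlat n1 n2 τ i j = 0} =>
          fun i => MmatFlat n1 n2 τ i j.1)) ∧
      (MmatFlat n1 n2 τ).det = 0 := by
  classical
  obtain ⟨hA, hB⟩ := card_par (n1 + 1) n2 he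
  have hN : 6 ≤ (n1 + 1) * n2 := by nlinarith
  have ha : ¬ LinearIndependent ℝ
        (fun i : {i : Fin ((n1 + 1) * n2 - 1) // (i : ℕ) % 2 = 0} =>
          MmatFlat n1 n2 τ i.1) := by
    intro hl
    have h3 := card_le_of_support _ (fun j : Fin ((n1 + 1) * n2 - 1) =>
      posPar (⟨(j : ℕ) + 1, by have := j.isLt; omega⟩ : Fin ((n1 + 1) * n2)) = 0)
      (fun i j hj => Mmat_par n1 n2 τ i.1 j (by rw [i.2]; exact hj)) hl
    have h4 : Fintype.card {j : Fin ((n1 + 1) * n2 - 1) //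
        posPar (⟨(j : ℕ) + 1, by have := j.isLt; omega⟩ : Fin ((n1 + 1) * n2)) = 0}
        < Fintype.card {p : Fin ((n1 + 1) * n2) // posPar p = 0} := by
      refine Fintype.card_lt_of_injective_of_notMem
        (fun j => ⟨⟨(j.1 : ℕ) + 1, by have := j.1.isLt; omega⟩, j.2⟩) ?_
        (b := ⟨⟨0, by omega⟩, posPar_zero _ rfl⟩) ?_
      · intro j j' hj
        simp only [Subtype.mk.injEq, Fin.mk.injEq] at hj
        exact Subtype.ext (Fin.ext (by omega))
      · rintro ⟨j, hj⟩
        simp at hj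
    have h5 : Fintype.card (Fin ((n1 + 1) * n2 / 2)) ≤
        Fintype.card {i : Fin ((n1 + 1) * n2 - 1) // (i : ℕ) % 2 = 0} := by
      refine Fintype.card_le_of_injective
        (fun i => ⟨⟨2 * (i : ℕ), by have := i.isLt; omega⟩, by simp⟩) ?_
      intro j j' hj
      simp only [Subtype.mk.injEq, Fin.mk.injEq] at hj
      exact Fin.ext (by omega)
    rw [Fintype.card_fin] at h5
    omega
  refine ⟨ha, ?_, ?_⟩
  · intro hl
    have h3 := card_le_of_support _ (fun i : Fin ((n1 + 1) * n2 - 1) => (i : ℕ) % 2 = 1)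
      (fun j i hi => j.2 i (by omega)) hl
    have h4 : Fintype.card {p : Fin ((n1 + 1) * n2) // posPar p = 1} ≤
        Fintype.card {j : Fin ((n1 + 1) * n2 - 1) //
            ∀ i : Fin ((n1 + 1) * n2 - 1), (i : ℕ) % 2 = 0 → MmatFlat n1 n2 τ i j = 0} := by
      have hpos : ∀ p : {p : Fin ((n1 + 1) * n2) // posPar p = 1}, (p.1 : ℕ) ≠ 0 := by
        intro p h0
        have := posPar_zero p.1 h0
        have := p.2
        omega
      refine Fintype.card_le_of_injective
        (fun p => ⟨⟨(p.1 : ℕ) - 1, by have := p.1.isLt; have := hpos p; omega⟩, ?_⟩) ?_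
      · intro i hi
        apply Mmat_par
        have hp := hpos p
        have : (⟨(p.1 : ℕ) - 1 + 1, by have := p.1.isLt; omega⟩ : Fin ((n1 + 1) * n2)) = p.1 :=
          Fin.ext (by simp only; omega)
        simp only [this, p.2, hi]
        exact one_ne_zero
      · intro p p' hp
        simp only [Subtype.mk.injEq, Fin.mk.injEq] at hp
        have := hpos p
        have := hpos p'
        exact Subtype.ext (Fin.ext (by omega))
    have h5 : Fintype.card {i : Fin ((n1 + 1) * n2 - 1) // (i : ℕ) % 2 = 1} ≤
        Fintype.card (Fin ((n1 + 1) * n2 / 2 - 1)) := by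
      obtain ⟨c, hc⟩ := he
      refine Fintype.card_le_of_injective
        (fun i => ⟨(i.1 : ℕ) / 2, by have := i.1.isLt; have := i.2; omega⟩) ?_
      intro j j' hj
      simp only [Fin.mk.injEq] at hj
      have := j.2
      have := j'.2
      exact Subtype.ext (Fin.ext (by omega))
    rw [Fintype.card_fin] at h5
    omega
  · by_contra hd
    have := Matrix.linearIndependent_rows_of_det_ne_zero hd
    exact ha (this.comp _ Subtype.val_injective)
end
end
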